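/- arXiv:0712.3238 — 4 statements merged into one kernel-verified Lean document; each statement's English description precedes it below -/
import Mathlib

section
/- Let k be a real number and E a complex number, and set κ = −k and let μ be a complex number with μ² = −E. Let f : ℂ be a function defined and twice differentiable on the positive reals, and define φ(u) = exp(−u/2)·f(exp(u)) for real u. Then φ satisfies the Schrödinger equation −φ''(u) + V_k(u)·φ(u) = E·φ(u) for all real u if and only if f satisfies Whittaker's differential equation f''(x) + (−1/4 + κ/x + (1/4 − μ²)/x²)·f(x) = 0 for all x > 0. -/
/-- The Morse potential `V_k(u) = (1/4)·exp(2u) + k·exp(u)`. -/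
noncomputable def morse (k u : ℝ) : ℝ := (1/4) * Real.exp (2*u) + k * Real.exp u

/-- Transformation between the Schrödinger equation with Morse potential and
Whittaker's differential equation. -/
theorem stmt_0 (k : ℝ) (E μ : ℂ) (hμ : μ^2 = -E) (f : ℝ → ℂ)
    (hf : ∀ x : ℝ, 0 < x → DifferentiableAt ℝ f x)
    (hf' : ∀ x : ℝ, 0 < x → DifferentiableAt ℝ (deriv f) x)
    (φ : ℝ → ℂ) (hφ : ∀ u : ℝ, φ u = Complex.exp (-(u:ℂ)/2) * f (Real.exp u)) :
    (∀ u : ℝ, -(deriv (deriv φ) u) + (morse k u : ℂ) * φ u = E * φ u) ↔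
    (∀ x : ℝ, 0 < x → deriv (deriv f) x +
      (-(1/4) + (-(k:ℂ))/(x:ℂ) + (1/4 - μ^2)/(x:ℂ)^2) * f x = 0) := by
  have hE : ∀ u : ℝ, HasDerivAt (fun u : ℝ => Complex.exp (-(u:ℂ)/2))
      (Complex.exp (-(u:ℂ)/2) * (-1/2)) u := by
    intro u
    have h1 : HasDerivAt (fun u : ℝ => (u:ℂ)) 1 u := Complex.ofRealCLM.hasDerivAt
    exact (h1.neg.div_const 2).cexp
  have hX : ∀ u : ℝ, HasDerivAt (fun u : ℝ => ((Real.exp u : ℝ) : ℂ))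
      ((Real.exp u : ℝ) : ℂ) u := fun u => (Real.hasDerivAt_exp u).ofReal_comp
  have hc : ∀ g : ℝ → ℂ, (∀ x : ℝ, 0 < x → DifferentiableAt ℝ g x) → ∀ u : ℝ,
      HasDerivAt (fun u : ℝ => g (Real.exp u))
        (((Real.exp u : ℝ) : ℂ) * deriv g (Real.exp u)) u := by
    intro g hg u
    have h := (hg _ (Real.exp_pos u)).hasDerivAt.scomp u (Real.hasDerivAt_exp u)
    simpa [Function.comp_def] using h
  have hφ0 : φ = fun u : ℝ => Complex.exp (-(u:ℂ)/2) * f (Real.exp u) := funext hφ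
  have hd1 : deriv φ = fun u : ℝ => Complex.exp (-(u:ℂ)/2) *
      ((-1/2) * f (Real.exp u) + ((Real.exp u : ℝ) : ℂ) * deriv f (Real.exp u)) := by
    funext u
    rw [hφ0]
    refine Eq.trans (HasDerivAt.deriv ((hE u).mul (hc f hf u))) ?_
    ring
  have hd2 : ∀ u : ℝ, deriv (deriv φ) u = Complex.exp (-(u:ℂ)/2) *
      ((1/4) * f (Real.exp u) + ((Real.exp u : ℝ) : ℂ)^2 * deriv (deriv f) (Real.exp u)) := by
    intro u
    rw [hd1]
    have h := (hE u).mul (((hc f hf u).const_mul (-1/2 : ℂ)).add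
      ((hX u).mul (hc (deriv f) hf' u)))
    refine Eq.trans (HasDerivAt.deriv h) ?_
    simp only [Pi.add_apply, Pi.mul_apply]
    ring
  have key : ∀ u : ℝ, -(deriv (deriv φ) u) + (morse k u : ℂ) * φ u - E * φ u =
      -(Complex.exp (-(u:ℂ)/2) * ((Real.exp u : ℝ) : ℂ)^2) *
      (deriv (deriv f) (Real.exp u) + (-(1/4) + (-(k:ℂ))/((Real.exp u : ℝ) : ℂ)
        + (1/4 - μ^2)/((Real.exp u : ℝ) : ℂ)^2) * f (Real.exp u)) := by
    intro u
    have hne : ((Real.exp u : ℝ) : ℂ) ≠ 0 := Complex.ofReal_ne_zero.mpr (Real.exp_pos u).ne'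
    have hm : (morse k u : ℂ) = (1/4) * ((Real.exp u : ℝ) : ℂ)^2 + k * ((Real.exp u : ℝ) : ℂ) := by
      have : Real.exp (2*u) = Real.exp u ^ 2 := by rw [← Real.exp_nat_mul]; norm_num
      rw [morse, this]
      push_cast
      ring
    rw [hd2, hm, hφ u, hμ]
    generalize ((Real.exp u : ℝ) : ℂ) = X at *
    field_simp
    ring
  have hfac : ∀ u : ℝ, -(Complex.exp (-(u:ℂ)/2) * ((Real.exp u : ℝ) : ℂ)^2) ≠ 0 := by
    intro u
    exact neg_ne_zero.mpr (mul_ne_zero (Complex.exp_ne_zero _)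
      (pow_ne_zero _ (Complex.ofReal_ne_zero.mpr (Real.exp_pos u).ne')))
  constructor
  · intro h x hx
    have hk := key (Real.log x)
    rw [sub_eq_zero.mpr (h _)] at hk
    have := (mul_eq_zero.mp hk.symm).resolve_left (hfac _)
    rwa [Real.exp_log hx] at this
  · intro h u
    rw [← sub_eq_zero, key, h _ (Real.exp_pos u), mul_zero]
end

section
/- For complex parameters κ and μ with 2μ+1 not a nonpositive integer, the function f(x) = M_{κ,μ}(x) is twice differentiable on (0,∞) and satisfies Whittaker's differential equation f''(x) + (−1/4 + κ/x + (1/4 − μ²)/x²)·f(x) = 0 for all x > 0. -/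
/-- The Whittaker M-function `M_{κ,μ}(x)` for real `x > 0`, defined by its series. -/
noncomputable def whittakerM (κ μ : ℂ) (x : ℝ) : ℂ :=
  Complex.exp (-(x:ℂ)/2) * Complex.exp ((1/2 + μ) * (Real.log x : ℂ)) *
    ∑' j : ℕ, (Polynomial.eval (1/2 - κ + μ) (ascPochhammer ℂ j)) /
      ((Polynomial.eval (2*μ + 1) (ascPochhammer ℂ j)) * (Nat.factorial j : ℂ)) * (x:ℂ)^j

/-- The Whittaker W-function `W_{κ,μ}(x)` for real `x > 0` and `2μ` not an integer. -/
noncomputable def whittakerW (κ μ : ℂ) (x : ℝ) : ℂ :=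
  Complex.Gamma (-(2*μ)) / Complex.Gamma (1/2 - κ - μ) * whittakerM κ μ x +
  Complex.Gamma (2*μ) / Complex.Gamma (1/2 - κ + μ) * whittakerM κ (-μ) x

/-- Coefficient sequence of an entire power series. -/
def EntireCoeff (c : ℕ → ℂ) : Prop := ∀ R : ℝ, 0 < R → Summable (fun n => ‖c n‖ * R ^ n)

/-- Coefficients of the derivative. -/
noncomputable def dCoeff (c : ℕ → ℂ) (n : ℕ) : ℂ := ((n : ℂ) + 1) * c (n + 1)

theorem EntireCoeff.dCoeff {c : ℕ → ℂ} (hc : EntireCoeff c) : EntireCoeff (dCoeff c) := by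
  intro R hR
  have h1 := hc (2 * (R + 1)) (by positivity)
  have h2 := (summable_nat_add_iff 1).2 h1
  refine Summable.of_nonneg_of_le (fun n => by positivity) (fun n => ?_) h2
  have e : ‖_root_.dCoeff c n‖ = ((n : ℝ) + 1) * ‖c (n + 1)‖ := by
    unfold _root_.dCoeff
    rw [norm_mul]
    congr 1
    have := Complex.norm_natCast (n + 1)
    push_cast at this
    exact this
  rw [e]
  have h3 : ((n : ℝ) + 1) ≤ 2 ^ (n + 1) := by
    have := (Nat.lt_two_pow_self (n := n + 1)).le
    exact_mod_cast this
  have h4 : R ^ n ≤ (R + 1) ^ (n + 1) := by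
    calc R ^ n ≤ (R + 1) ^ n := by gcongr; linarith
      _ ≤ (R + 1) ^ (n + 1) := pow_le_pow_right₀ (by linarith) (by omega)
  calc ((n : ℝ) + 1) * ‖c (n + 1)‖ * R ^ n
      ≤ 2 ^ (n + 1) * ‖c (n + 1)‖ * (R + 1) ^ (n + 1) := by gcongr
    _ = _ := by rw [mul_pow]; ring

theorem EntireCoeff.summable {c : ℕ → ℂ} (hc : EntireCoeff c) (z : ℂ) :
    Summable (fun n => c n * z ^ n) := by
  refine Summable.of_norm_bounded (hc (‖z‖ + 1) (by positivity)) (fun n => ?_)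
  rw [norm_mul, norm_pow]
  gcongr
  linarith

theorem EntireCoeff.hasSum_shift {c : ℕ → ℂ} (hc : EntireCoeff c) (z : ℂ) :
    HasSum (fun n : ℕ => (n : ℂ) * c n * z ^ n) (z * ∑' n, _root_.dCoeff c n * z ^ n) := by
  have h := (hc.dCoeff.summable z).hasSum.mul_left z
  rw [← hasSum_nat_add_iff' 1]
  simp only [Finset.sum_range_one, Nat.cast_zero, zero_mul, sub_zero]
  refine (congrArg (fun f : ℕ → ℂ => HasSum f _) (funext fun n => ?_)).mpr h
  simp only [_root_.dCoeff]
  push_cast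
  ring

theorem EntireCoeff.hasDerivAt {c : ℕ → ℂ} (hc : EntireCoeff c) (z : ℂ) :
    HasDerivAt (fun w : ℂ => ∑' n, c n * w ^ n) (∑' n, _root_.dCoeff c n * z ^ n) z := by
  set R : ℝ := ‖z‖ + 1 with hR
  have hR0 : 0 < R := by positivity
  have hs := hc.dCoeff R hR0
  have hu : Summable (fun n : ℕ => (n : ℝ) * ‖c n‖ * R ^ (n - 1)) := by
    rw [← summable_nat_add_iff 1]
    refine hs.congr (fun n => ?_)
    unfold _root_.dCoeff
    have := Complex.norm_natCast (n + 1)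
    push_cast at this
    rw [norm_mul, this]
    simp
  have key := hasDerivAt_tsum_of_isPreconnected (𝕜 := ℂ) (F := ℂ)
    (g := fun n w => c n * w ^ n) (g' := fun n w => c n * ((n : ℂ) * w ^ (n - 1)))
    (t := Metric.ball 0 R) (y₀ := 0) (y := z) hu Metric.isOpen_ball
    (convex_ball (0 : ℂ) R).isPreconnected
    (fun n w _ => (hasDerivAt_pow n w).const_mul (c n))
    (fun n w hw => by
      rw [mem_ball_zero_iff] at hw
      rw [norm_mul, norm_mul, norm_pow, Complex.norm_natCast]
      calc ‖c n‖ * ((n : ℝ) * ‖w‖ ^ (n - 1)) ≤ ‖c n‖ * ((n : ℝ) * R ^ (n - 1)) := by gcongr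
        _ = _ := by ring)
    (Metric.mem_ball_self hR0) (hc.summable 0)
    (by rw [mem_ball_zero_iff]; linarith)
  have h2 : HasSum (fun n : ℕ => c n * ((n : ℂ) * z ^ (n - 1)))
      (∑' n, _root_.dCoeff c n * z ^ n) := by
    rw [← hasSum_nat_add_iff' 1]
    simp only [Finset.sum_range_one, Nat.cast_zero, zero_mul, mul_zero, sub_zero]
    refine (congrArg (fun f : ℕ → ℂ => HasSum f _) (funext fun n => ?_)).mpr (hc.dCoeff.summable z).hasSum
    simp only [_root_.dCoeff]
    push_cast
    ring
  exact key.congr_deriv h2.tsum_eq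

theorem kummer_entire {c : ℕ → ℂ} {a b : ℂ} (hb : ∀ n : ℕ, b + n ≠ 0)
    (hc : ∀ n : ℕ, (b + n) * ((n : ℂ) + 1) * c (n + 1) = (a + n) * c n) : EntireCoeff c := by
  intro R hR
  refine summable_of_ratio_norm_eventually_le (r := 1 / 2) (by norm_num) ?_
  obtain ⟨N, hN⟩ := exists_nat_gt (2 * ‖b‖ + ‖a‖ + 8 * R)
  filter_upwards [Filter.eventually_ge_atTop N] with n hn
  have hn' : (N : ℝ) ≤ n := by exact_mod_cast hn
  have ha0 := norm_nonneg a
  have hb0 := norm_nonneg b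
  have hnpos : (0 : ℝ) < n := by linarith
  have e1 : ‖a + n‖ ≤ 2 * n := by
    have := norm_add_le a (n : ℂ)
    rw [Complex.norm_natCast] at this
    linarith
  have e2 : (n : ℝ) / 2 ≤ ‖b + n‖ := by
    have := norm_sub_le (b + n) b
    rw [add_sub_cancel_left, Complex.norm_natCast] at this
    linarith
  have e3 := congrArg norm (hc n)
  have e4 := Complex.norm_natCast (n + 1)
  push_cast at e4
  rw [norm_mul, norm_mul, norm_mul, e4] at e3
  have h0 := norm_nonneg (c n)
  have h1 := norm_nonneg (c (n + 1))
  have e5 : (n : ℝ) / 2 * (8 * R) * ‖c (n + 1)‖ ≤ 2 * n * ‖c n‖ := by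
    calc (n : ℝ) / 2 * (8 * R) * ‖c (n + 1)‖
        ≤ ‖b + n‖ * ((n : ℝ) + 1) * ‖c (n + 1)‖ := by gcongr; linarith
      _ = ‖a + n‖ * ‖c n‖ := e3
      _ ≤ _ := by gcongr
  have e6 : 2 * R * ‖c (n + 1)‖ ≤ ‖c n‖ := by
    have : (2 * n : ℝ) * (2 * R * ‖c (n + 1)‖) ≤ 2 * n * ‖c n‖ := by linarith
    exact le_of_mul_le_mul_left this (by positivity)
  rw [Real.norm_of_nonneg (by positivity), Real.norm_of_nonneg (by positivity)]
  calc ‖c (n + 1)‖ * R ^ (n + 1) = 1 / 2 * ((2 * R * ‖c (n + 1)‖) * R ^ n) := by ring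
    _ ≤ _ := by gcongr

theorem kummer_ode {c : ℕ → ℂ} {a b : ℂ} (hE : EntireCoeff c)
    (hc : ∀ n : ℕ, (b + n) * ((n : ℂ) + 1) * c (n + 1) = (a + n) * c n) (z : ℂ) :
    z * (∑' n, dCoeff (dCoeff c) n * z ^ n) + (b - z) * (∑' n, dCoeff c n * z ^ n)
      - a * (∑' n, c n * z ^ n) = 0 := by
  have h1 := hE.dCoeff.hasSum_shift z
  have h2 := hE.hasSum_shift z
  have h3 := (hE.dCoeff.summable z).hasSum.mul_left b
  have h4 := (hE.summable z).hasSum.mul_left a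
  have h5 := ((h1.add h3).sub h2).sub h4
  have h6 : (fun n : ℕ => (n : ℂ) * dCoeff c n * z ^ n + b * (dCoeff c n * z ^ n)
      - (n : ℂ) * c n * z ^ n - a * (c n * z ^ n)) = fun _ => 0 := by
    funext n
    have := hc n
    simp only [dCoeff]
    linear_combination z ^ n * this
  rw [h6] at h5
  have h7 := h5.unique hasSum_zero
  linear_combination h7

/-- The Whittaker M-function satisfies Whittaker's differential equation on `(0,∞)`. -/
theorem stmt_1 (κ μ : ℂ) (h : ∀ n : ℕ, 2*μ + 1 ≠ -(n:ℂ)) :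
    (∀ x : ℝ, 0 < x → DifferentiableAt ℝ (fun t : ℝ => whittakerM κ μ t) x) ∧
    (∀ x : ℝ, 0 < x → DifferentiableAt ℝ (deriv (fun t : ℝ => whittakerM κ μ t)) x) ∧
    (∀ x : ℝ, 0 < x → deriv (deriv (fun t : ℝ => whittakerM κ μ t)) x +
      (-(1/4) + κ/(x:ℂ) + (1/4 - μ^2)/(x:ℂ)^2) * whittakerM κ μ x = 0) := by
  set c : ℕ → ℂ := fun j => (Polynomial.eval (1/2 - κ + μ) (ascPochhammer ℂ j)) /
      ((Polynomial.eval (2*μ + 1) (ascPochhammer ℂ j)) * (Nat.factorial j : ℂ)) with hcdef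
  have hb : ∀ n : ℕ, (2*μ + 1) + (n : ℂ) ≠ 0 := fun n hn => h n (eq_neg_of_add_eq_zero_left hn)
  have hP : ∀ n : ℕ, Polynomial.eval (2*μ + 1) (ascPochhammer ℂ n) ≠ 0 := by
    intro n
    induction n with
    | zero => simp
    | succ n ih =>
      rw [ascPochhammer_succ_eval]
      exact mul_ne_zero ih (hb n)
  have hc : ∀ n : ℕ, ((2*μ + 1) + n) * ((n : ℂ) + 1) * c (n + 1) = ((1/2 - κ + μ) + n) * c n := by
    intro n
    have i1 := hP n
    have i2 := hb n
    have i3 : ((n : ℂ) + 1) ≠ 0 := Nat.cast_add_one_ne_zero n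
    have i4 : (Nat.factorial n : ℂ) ≠ 0 := by exact_mod_cast Nat.factorial_ne_zero n
    simp only [hcdef]
    rw [ascPochhammer_succ_eval, ascPochhammer_succ_eval, Nat.factorial_succ]
    push_cast
    generalize Polynomial.eval (2*μ + 1) (ascPochhammer ℂ n) = p at *
    generalize Polynomial.eval (1/2 - κ + μ) (ascPochhammer ℂ n) = q at *
    generalize (Nat.factorial n : ℂ) = f at *
    generalize (n : ℂ) = m at *
    rw [mul_div_assoc', mul_div_assoc', div_eq_div_iff (mul_ne_zero (mul_ne_zero i1 i2) (mul_ne_zero i3 i4)) (mul_ne_zero i1 i4)]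
    ring
  have hE := kummer_entire hb hc
  set F : ℂ → ℂ := fun w => ∑' n, c n * w ^ n with hF
  set F1 : ℂ → ℂ := fun w => ∑' n, dCoeff c n * w ^ n with hF1
  set F2 : ℂ → ℂ := fun w => ∑' n, dCoeff (dCoeff c) n * w ^ n with hF2
  have dF : ∀ x : ℝ, HasDerivAt (fun t : ℝ => F t) (F1 x) x := fun x =>
    (hE.hasDerivAt (x : ℂ)).comp_ofReal
  have dF1 : ∀ x : ℝ, HasDerivAt (fun t : ℝ => F1 t) (F2 x) x := fun x =>
    (hE.dCoeff.hasDerivAt (x : ℂ)).comp_ofReal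
  have ode : ∀ z : ℂ, z * F2 z + ((2*μ + 1) - z) * F1 z - (1/2 - κ + μ) * F z = 0 :=
    fun z => kummer_ode hE hc z
  set E : ℝ → ℂ := fun x =>
    Complex.exp (-(x:ℂ)/2) * Complex.exp ((1/2 + μ) * (Real.log x : ℂ)) with hEdef
  have hM : (fun t : ℝ => whittakerM κ μ t) = fun t => E t * F t := rfl
  have hMx : ∀ x, whittakerM κ μ x = E x * F x := fun _ => rfl
  have dId : ∀ x : ℝ, HasDerivAt (fun t : ℝ => (t : ℂ)) 1 x := fun x =>
    Complex.ofRealCLM.hasDerivAt (x := x)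
  have dE : ∀ x : ℝ, 0 < x → HasDerivAt E (E x * (-1/2 + (1/2 + μ) / (x : ℂ))) x := by
    intro x hx
    have l := (Real.hasDerivAt_log hx.ne').ofReal_comp
    have h1 := ((dId x).neg.div_const 2).cexp
    have h2 := (l.const_mul (1/2 + μ)).cexp
    refine (h1.mul h2).congr_deriv ?_
    simp only [hEdef, Pi.neg_apply]
    push_cast
    ring
  have dM : ∀ x : ℝ, 0 < x → HasDerivAt (fun t : ℝ => whittakerM κ μ t)
      (E x * ((-1/2 + (1/2 + μ) * (x : ℂ)⁻¹) * F x + F1 x)) x := by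
    intro x hx
    rw [hM]
    refine ((dE x hx).mul (dF x)).congr_deriv ?_
    ring
  have dM2 : ∀ x : ℝ, 0 < x → HasDerivAt (deriv (fun t : ℝ => whittakerM κ μ t))
      (-((-(1/4) + κ/(x:ℂ) + (1/4 - μ^2)/(x:ℂ)^2) * whittakerM κ μ x)) x := by
    intro x hx
    have hx' : (x : ℂ) ≠ 0 := by exact_mod_cast hx.ne'
    have ev : deriv (fun t : ℝ => whittakerM κ μ t) =ᶠ[nhds x]
        fun t => E t * ((-1/2 + (1/2 + μ) * (t : ℂ)⁻¹) * F t + F1 t) := by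
      filter_upwards [lt_mem_nhds hx] with t ht
      exact (dM t ht).deriv
    refine HasDerivAt.congr_of_eventuallyEq ?_ ev
    have dI : HasDerivAt (fun t : ℝ => (t : ℂ)⁻¹) (-1 / (x : ℂ) ^ 2) x := (dId x).inv hx'
    have := (dE x hx).mul ((((dI.const_mul (1/2 + μ)).const_add (-1/2)).mul (dF x)).add (dF1 x))
    refine this.congr_deriv ?_
    rw [hMx]
    have o := ode x
    have o2 : F2 x = -(((2*μ + 1) - x) * F1 x - (1/2 - κ + μ) * F x) / x := by
      rw [eq_div_iff hx']
      linear_combination o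
    simp only [Pi.add_apply, Pi.mul_apply]
    rw [o2]
    field_simp
    ring
  refine ⟨fun x hx => (dM x hx).differentiableAt, fun x hx => (dM2 x hx).differentiableAt,
    fun x hx => ?_⟩
  rw [(dM2 x hx).deriv]
  ring
end

section
/- Fix a real α with 0 ≤ α < 2π and a real k ≥ 0, and let u₀ < u₀' be real numbers. Suppose e : ℕ → ℝ and e' : ℕ → ℝ are strictly increasing functions whose ranges are exactly S(α, u₀, V_k) and S(α, u₀', V_k) respectively. Then for every n, e(n) < e'(n); that is, each eigenvalue in the increasing enumeration is a strictly increasing function of the left endpoint u₀. -/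
open MeasureTheory in
/-- The set of eigenvalues of the Schrödinger operator `-d²/du² + V` on `[u₀,∞)`
with boundary condition `cos α · ψ(u₀) + sin α · ψ'(u₀) = 0`. -/
def evSet (α u₀ : ℝ) (V : ℝ → ℝ) : Set ℝ :=
  {E | ∃ ψ : ℝ → ℝ,
    (∀ u, DifferentiableAt ℝ ψ u) ∧ (∀ u, DifferentiableAt ℝ (deriv ψ) u) ∧
    (∃ u, u₀ ≤ u ∧ ψ u ≠ 0) ∧
    IntegrableOn (fun u => (ψ u)^2) (Set.Ici u₀) ∧
    (∀ u, u₀ ≤ u → -(deriv (deriv ψ) u) + V u * ψ u = E * ψ u) ∧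
    Real.cos α * ψ u₀ + Real.sin α * deriv ψ u₀ = 0}

namespace Pruefer

open Real Set Filter Topology MeasureTheory

/-- Pruefer equation. -/
def IsP (Q θ : ℝ → ℝ) : Prop :=
  ∀ x, HasDerivAt θ (cos (θ x) ^ 2 - Q x * sin (θ x) ^ 2) x

lemma sinsq_lip (a b : ℝ) : |sin a ^ 2 - sin b ^ 2| ≤ |a - b| := by
  have h : sin a ^ 2 - sin b ^ 2 = sin (a + b) * sin (a - b) := by
    rw [sin_add, sin_sub]
    nlinarith [sin_sq_add_cos_sq a, sin_sq_add_cos_sq b]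
  rw [h, abs_mul]
  have h1 := abs_sin_le_one (a + b)
  have h2 : |sin (a - b)| ≤ |a - b| := abs_sin_le_abs
  nlinarith [abs_nonneg (sin (a - b)), abs_nonneg (sin (a + b))]

lemma rhs_eq (q t : ℝ) : cos t ^ 2 - q * sin t ^ 2 = 1 - (1 + q) * sin t ^ 2 := by
  rw [cos_sq']; ring

lemma rhs_lip {q M : ℝ} (h : |q| ≤ M) (a b : ℝ) :
    |(cos a ^ 2 - q * sin a ^ 2) - (cos b ^ 2 - q * sin b ^ 2)| ≤ (1 + M) * |a - b| := by
  rw [rhs_eq, rhs_eq]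
  have : (1 - (1 + q) * sin a ^ 2) - (1 - (1 + q) * sin b ^ 2)
      = -((1 + q) * (sin a ^ 2 - sin b ^ 2)) := by ring
  rw [this, abs_neg, abs_mul]
  have h1 : |1 + q| ≤ 1 + M := (abs_add_le _ _).trans (by simpa using h)
  exact mul_le_mul h1 (sinsq_lip a b) (abs_nonneg _) ((abs_nonneg _).trans h1)

lemma exists_bound {Q : ℝ → ℝ} (hQ : Continuous Q) (T : ℝ) :
    ∃ M, 0 ≤ M ∧ ∀ x ∈ Icc (-T) T, |Q x| ≤ M := by
  obtain ⟨M, hM⟩ := (isCompact_Icc (a := -T) (b := T)).exists_bound_of_continuousOn hQ.continuousOn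
  exact ⟨max M 0, le_max_right _ _, fun x hx => (hM x hx).trans (le_max_left _ _)⟩

lemma exists_local {Q : ℝ → ℝ} (hQ : Continuous Q) (c : ℝ) {T : ℝ} (hT : 0 < T) :
    ∃ θ : ℝ → ℝ, θ 0 = c ∧ ∀ x ∈ Ioo (-T) T,
      HasDerivAt θ (cos (θ x) ^ 2 - Q x * sin (θ x) ^ 2) x := by
  obtain ⟨M, hM0, hM⟩ := exists_bound hQ T
  let K : NNReal := ⟨1 + M, by linarith⟩
  let A : NNReal := ⟨(1 + M) * T, by positivity⟩
  have hpl : IsPicardLindelof (fun t θ => cos θ ^ 2 - Q t * sin θ ^ 2)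
      (⟨0, by constructor <;> linarith⟩ : Icc (-T) T) c A 0 K K := by
    refine ⟨?_, ?_, ?_, ?_⟩
    · intro t ht
      refine LipschitzOnWith.of_dist_le_mul fun a _ b _ => ?_
      exact rhs_lip (hM t ht) a b
    · intro x _
      exact (by fun_prop : Continuous fun t => cos x ^ 2 - Q t * sin x ^ 2).continuousOn
    · intro t ht x _
      have h := abs_le.1 (hM t ht)
      rw [Real.norm_eq_abs]
      change _ ≤ 1 + M
      have h1 := sin_sq_add_cos_sq x
      rw [abs_le]
      constructor <;> nlinarith [sq_nonneg (sin x), sq_nonneg (cos x)]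
    · simp [K, A]
      exact le_rfl
  obtain ⟨θ, h0, h⟩ := hpl.exists_eq_forall_mem_Icc_hasDerivWithinAt₀
  exact ⟨θ, h0, fun x hx => (h x (Ioo_subset_Icc_self hx)).hasDerivAt (Icc_mem_nhds hx.1 hx.2)⟩

lemma exists_sol {Q : ℝ → ℝ} (hQ : Continuous Q) (c : ℝ) :
    ∃ θ : ℝ → ℝ, θ 0 = c ∧ IsP Q θ := by
  choose θ h0 h using fun n : ℕ => exists_local hQ c (T := (n : ℝ) + 1) (by positivity)
  have key : ∀ n m : ℕ, n ≤ m → ∀ x ∈ Ioo (-((n : ℝ) + 1)) ((n : ℝ) + 1), θ n x = θ m x := by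
    intro n m hnm x hx
    have hnm' : (n : ℝ) ≤ m := by exact_mod_cast hnm
    obtain ⟨M, hM0, hM⟩ := exists_bound hQ ((n : ℝ) + 1)
    refine ODE_solution_unique_of_mem_Ioo (v := fun t θ => cos θ ^ 2 - Q t * sin θ ^ 2)
      (s := fun _ => univ) (K := ⟨1 + M, by linarith⟩) (t₀ := 0) (a := -((n : ℝ) + 1))
      (b := (n : ℝ) + 1)
      ?_ ?_ ?_ ?_ ?_ hx
    · intro t ht
      refine LipschitzOnWith.of_dist_le_mul fun a _ b _ => ?_
      exact rhs_lip (hM t (Ioo_subset_Icc_self ht)) a b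
    · constructor
      · have : (0 : ℝ) ≤ n := by positivity
        linarith
      · positivity
    · exact fun t ht => ⟨h n t ht, trivial⟩
    · exact fun t ht => ⟨h m t ⟨by linarith [ht.1], by linarith [ht.2]⟩, trivial⟩
    · rw [h0, h0]
  let Θ : ℝ → ℝ := fun x => θ ⌈|x|⌉₊ x
  have hΘ : ∀ n : ℕ, ∀ x ∈ Ioo (-((n : ℝ) + 1)) ((n : ℝ) + 1), Θ x = θ n x := by
    intro n x hx
    have hx' : x ∈ Ioo (-((⌈|x|⌉₊ : ℝ) + 1)) ((⌈|x|⌉₊ : ℝ) + 1) := by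
      have := Nat.le_ceil |x|
      rw [mem_Ioo, ← abs_lt]; linarith
    rcases le_total ⌈|x|⌉₊ n with hle | hle
    · exact key _ _ hle x hx'
    · exact (key _ _ hle x hx).symm
  refine ⟨Θ, ?_, ?_⟩
  · rw [hΘ 0 0 (by simp), h0]
  · intro x
    have hx' : x ∈ Ioo (-((⌈|x|⌉₊ : ℝ) + 1)) ((⌈|x|⌉₊ : ℝ) + 1) := by
      have := Nat.le_ceil |x|
      rw [mem_Ioo, ← abs_lt]; linarith
    have hd := h ⌈|x|⌉₊ x hx'
    have he : Θ =ᶠ[𝓝 x] θ ⌈|x|⌉₊ := by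
      filter_upwards [Ioo_mem_nhds hx'.1 hx'.2] with y hy using hΘ _ y hy
    exact hd.congr_of_eventuallyEq he

lemma IsP.cont {Q θ : ℝ → ℝ} (h : IsP Q θ) : Continuous θ :=
  continuous_iff_continuousAt.2 fun x => (h x).continuousAt

/-- quantitative comparison -/
lemma compare_eps {Q Q' θ θ' : ℝ → ℝ} (h : IsP Q θ) (h' : IsP Q' θ') {T M ε : ℝ}
    (hM : ∀ x ∈ Icc 0 T, |Q x| ≤ M) (hε : 0 < ε) (hQ : ∀ x ∈ Icc 0 T, Q' x ≤ Q x + ε)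
    (h0 : θ 0 ≤ θ' 0) : ∀ x ∈ Icc 0 T, θ x - θ' x ≤ ε * exp ((M + 3) * x) := by
  intro x hx
  refine image_le_of_deriv_right_lt_deriv_boundary (f := fun x => θ x - θ' x)
    (f' := fun x => (cos (θ x) ^ 2 - Q x * sin (θ x) ^ 2)
      - (cos (θ' x) ^ 2 - Q' x * sin (θ' x) ^ 2))
    (B := fun x => ε * exp ((M + 3) * x)) (B' := fun x => ε * (exp ((M + 3) * x) * (M + 3)))
    (a := 0) (b := T) (h.cont.sub h'.cont).continuousOn
    (fun x _ => ((h x).sub (h' x)).hasDerivWithinAt) ?_ ?_ ?_ hx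
  · simp; linarith
  · intro x
    simpa using (((hasDerivAt_id x).const_mul (M + 3)).exp.const_mul ε)
  · intro x hx heq
    have hx' := Ico_subset_Icc_self hx
    have hM0 : 0 ≤ M := (abs_nonneg _).trans (hM x hx')
    have hB : ε ≤ ε * exp ((M + 3) * x) := by
      have : 1 ≤ exp ((M + 3) * x) := one_le_exp (mul_nonneg (by linarith) hx.1)
      nlinarith
    have h1 := (abs_le.1 (rhs_lip (hM x hx') (θ x) (θ' x))).2
    rw [heq, abs_of_pos (lt_of_lt_of_le hε hB)] at h1
    have h2 : (Q' x - Q x) * sin (θ' x) ^ 2 ≤ ε := by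
      have a1 := hQ x hx'
      have a2 := sin_sq_le_one (θ' x)
      nlinarith [sq_nonneg (sin (θ' x))]
    nlinarith

lemma compare {Q Q' θ θ' : ℝ → ℝ} (hc : Continuous Q) (h : IsP Q θ) (h' : IsP Q' θ')
    (hQ : ∀ x, 0 ≤ x → Q' x ≤ Q x) (h0 : θ 0 ≤ θ' 0) : ∀ x, 0 ≤ x → θ x ≤ θ' x := by
  intro x hx
  obtain ⟨M, hM0, hM⟩ := exists_bound hc x
  by_contra hlt
  push Not at hlt
  have hE := exp_pos ((M + 3) * x)
  have := compare_eps h h' (T := x) (M := M) (ε := (θ x - θ' x) / (2 * exp ((M + 3) * x)))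
    (fun y hy => hM y ⟨by linarith [hy.1], hy.2⟩) (div_pos (by linarith) (by positivity))
    (fun y hy => (hQ y hy.1).trans (by
      have : 0 < (θ x - θ' x) / (2 * exp ((M + 3) * x)) := div_pos (by linarith) (by positivity)
      linarith)) h0 x ⟨hx, le_rfl⟩
  have e : (θ x - θ' x) / (2 * exp ((M + 3) * x)) * exp ((M + 3) * x) = (θ x - θ' x) / 2 := by
    field_simp
  rw [e] at this
  linarith

/-- continuity in the energy -/
lemma cont_energy {W : ℝ → ℝ} (hc : Continuous W) {Θ : ℝ → ℝ → ℝ}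
    (h : ∀ E, IsP (fun x => W x - E) (Θ E)) (h0 : ∀ E, Θ E 0 = Θ 0 0) {x : ℝ} (hx : 0 ≤ x) :
    Continuous fun E => Θ E x := by
  rw [Metric.continuous_iff]
  intro E δ hδ
  obtain ⟨M, hM0, hM⟩ := exists_bound (Q := fun y => W y - E) (by fun_prop) x
  set C := exp ((M + 1 + 3) * x) with hC
  have hCpos : 0 < C := exp_pos _
  refine ⟨min 1 (δ / (2 * C)), lt_min one_pos (by positivity), fun E' hE' => ?_⟩
  rw [Real.dist_eq, lt_min_iff] at hE'
  have hb : ∀ F, |F - E| < 1 → ∀ y ∈ Icc 0 x, |W y - F| ≤ M + 1 := by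
    intro F hF y hy
    have a1 := abs_le.1 (hM y ⟨by linarith [hy.1], hy.2⟩)
    have a2 := abs_lt.1 hF
    rw [abs_le]; constructor <;> linarith
  have a2 := abs_lt.1 hE'.2
  have hε : 0 < δ / (2 * C) := by positivity
  have k1 := compare_eps (h E) (h E') (T := x) (M := M + 1) (ε := δ / (2 * C))
    (hb E (by simp)) hε (fun y _ => by linarith) (by rw [h0 E, h0 E']) x ⟨hx, le_rfl⟩
  have k2 := compare_eps (h E') (h E) (T := x) (M := M + 1) (ε := δ / (2 * C))
    (hb E' hE'.1) hε (fun y _ => by linarith) (by rw [h0 E, h0 E']) x ⟨hx, le_rfl⟩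
  rw [← hC] at k1 k2
  have e : δ / (2 * C) * C = δ / 2 := by field_simp
  rw [e] at k1 k2
  rw [Real.dist_eq, abs_lt]
  constructor <;> linarith

lemma sin_int (j : ℤ) : sin (j * π) = 0 := sin_int_mul_pi j

lemma sq_cos_int (j : ℤ) : cos (j * π) ^ 2 = 1 := by
  have := sin_sq_add_cos_sq (j * π); rw [sin_int] at this; linarith

lemma cos_half (j : ℤ) : cos (j * π + π / 2) = 0 := by
  rw [cos_add_pi_div_two, sin_int, neg_zero]

lemma sq_sin_half (j : ℤ) : sin (j * π + π / 2) ^ 2 = 1 := by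
  rw [sin_add_pi_div_two, sq_cos_int]

lemma lower_trap {Q θ : ℝ → ℝ} (h : IsP Q θ) (j : ℤ) {a : ℝ} (ha : j * π ≤ θ a) :
    ∀ x, a ≤ x → j * π ≤ θ x := by
  intro x hx
  refine image_le_of_deriv_right_lt_deriv_boundary (f := fun _ => j * π) (f' := fun _ => 0)
    (B := θ) (a := a) (b := x) continuousOn_const (fun _ _ => hasDerivWithinAt_const _ _ _) ha h
    ?_ ⟨hx, le_rfl⟩
  intro y _ hy
  rw [← hy, sin_int, sq_cos_int]; norm_num

lemma upper_trap {Q θ : ℝ → ℝ} (h : IsP Q θ) (j : ℤ) {a : ℝ} (hQ : ∀ x, a ≤ x → 0 < Q x)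
    (ha : θ a ≤ j * π + π / 2) : ∀ x, a ≤ x → θ x ≤ j * π + π / 2 := by
  intro x hx
  refine image_le_of_deriv_right_lt_deriv_boundary (f := θ)
    (f' := fun x => cos (θ x) ^ 2 - Q x * sin (θ x) ^ 2)
    (B := fun _ => j * π + π / 2) (B' := fun _ => 0) (a := a) (b := x) h.cont.continuousOn
    (fun y _ => (h y).hasDerivWithinAt) ha (fun _ => hasDerivAt_const _ _)
    ?_ ⟨hx, le_rfl⟩
  intro y hy he
  have := hQ y hy.1
  rw [he, cos_half, sq_sin_half]; linarith

lemma no_pos_deriv {h : ℝ → ℝ} {x d : ℝ} (hd : HasDerivAt h d x) (hpos : 0 < d) (h0 : h x = 0)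
    (hle : ∀ y, x ≤ y → h y ≤ 0) : False := by
  have h1 := (hasDerivAt_iff_tendsto_slope.1 hd).eventually (lt_mem_nhds hpos)
  have h2 : ∀ᶠ y in 𝓝[>] x, 0 < slope h x y :=
    h1.filter_mono (nhdsWithin_mono _ fun y hy => ne_of_gt hy)
  obtain ⟨y, hy, hxy⟩ := (h2.and self_mem_nhdsWithin).exists
  rw [slope_def_field, h0] at hy
  have hxy : x < y := hxy
  have : h y / (y - x) ≤ 0 := div_nonpos_of_nonpos_of_nonneg (hle y hxy.le) (by linarith)
  simp only [sub_zero] at hy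
  linarith

/-- stuck lemma -/
lemma stuck {Q θ : ℝ → ℝ} (h : IsP Q θ) {X : ℝ} (hQ : ∀ x, X ≤ x → 0 < Q x)
    (hs : ∀ x, X ≤ x → sin (θ x) * cos (θ x) ≤ 0) :
    ∃ j : ℤ, ∀ x, X ≤ x → j * π + π / 2 < θ x ∧ θ x < j * π + π := by
  have hne : ∀ x, X ≤ x → sin (θ x) * cos (θ x) ≠ 0 := by
    intro x hx h0
    refine no_pos_deriv (h := fun x => sin (θ x) * cos (θ x)) ((h x).sin.mul (h x).cos) ?_ h0
      (fun y hy => hs y (hx.trans hy))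
    have hq := hQ x hx
    have h1 := sin_sq_add_cos_sq (θ x)
    rcases mul_eq_zero.1 h0 with h0 | h0
    · rw [h0] at h1 ⊢
      have : cos (θ x) ^ 2 = 1 := by linarith
      have e : cos (θ x) * (cos (θ x) ^ 2 - Q x * 0 ^ 2) * cos (θ x) +
        0 * (-0 * (cos (θ x) ^ 2 - Q x * 0 ^ 2)) = (cos (θ x) ^ 2) ^ 2 := by ring
      rw [e, this]; norm_num
    · rw [h0] at h1 ⊢
      have : sin (θ x) ^ 2 = 1 := by linarith
      have e : 0 * (0 ^ 2 - Q x * sin (θ x) ^ 2) * 0 +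
        sin (θ x) * (-sin (θ x) * (0 ^ 2 - Q x * sin (θ x) ^ 2)) = Q x * (sin (θ x) ^ 2) ^ 2 := by
        ring
      rw [e, this]; linarith
  have hπ := pi_pos
  set j := ⌊θ X / π⌋ with hj
  have hj1 : j * π ≤ θ X := by
    have := Int.floor_le (θ X / π); rwa [le_div_iff₀ hπ] at this
  have hj2 : θ X < j * π + π := by
    have := Int.lt_floor_add_one (θ X / π); rw [div_lt_iff₀ hπ] at this; linarith
  have hX : j * π + π / 2 < θ X ∧ θ X < j * π + π := by
    refine ⟨?_, hj2⟩
    by_contra hcon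
    push Not at hcon
    set t := θ X - j * π with ht
    have e : sin (θ X) * cos (θ X) = sin t * cos t := by
      have : θ X = t + j * π := by rw [ht]; ring
      rw [this, sin_add_int_mul_pi, cos_add_int_mul_pi]
      have : ((-1 : ℝ) ^ j) * ((-1 : ℝ) ^ j) = 1 := by
        rw [← mul_zpow]; norm_num
      calc _ = ((-1 : ℝ) ^ j) * ((-1 : ℝ) ^ j) * (sin t * cos t) := by ring
        _ = _ := by rw [this, one_mul]
    have s1 : 0 ≤ sin t := sin_nonneg_of_nonneg_of_le_pi (by linarith) (by linarith)
    have s2 : 0 ≤ cos t := cos_nonneg_of_neg_pi_div_two_le_of_le (by linarith) (by linarith)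
    exact hne X le_rfl (le_antisymm (hs X le_rfl) (e ▸ mul_nonneg s1 s2))
  refine ⟨j, fun x hx => ?_⟩
  constructor
  · by_contra hcon
    push Not at hcon
    obtain ⟨y, hy, hy'⟩ := intermediate_value_Icc' hx h.cont.continuousOn ⟨hcon, hX.1.le⟩
    exact hne y hy.1 (by rw [hy', cos_half, mul_zero])
  · by_contra hcon
    push Not at hcon
    obtain ⟨y, hy, hy'⟩ := intermediate_value_Icc hx h.cont.continuousOn ⟨hX.2.le, hcon⟩
    refine hne y hy.1 ?_
    rw [hy', sin_add_pi, sin_int, neg_zero, zero_mul]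

lemma sincos_nonpos {t : ℝ} (j : ℤ) (h1 : j * π + π / 2 ≤ t) (h2 : t ≤ j * π + π) :
    sin t * cos t ≤ 0 := by
  set s := t - j * π with hs
  have e : t = s + j * π := by rw [hs]; ring
  have hπ := pi_pos
  have : ((-1 : ℝ) ^ j) * ((-1 : ℝ) ^ j) = 1 := by
    rw [← mul_zpow]; norm_num
  rw [e, sin_add_int_mul_pi, cos_add_int_mul_pi]
  have s1 : 0 ≤ sin s := sin_nonneg_of_nonneg_of_le_pi (by linarith) (by linarith)
  have s2 : cos s ≤ 0 := cos_nonpos_of_pi_div_two_le_of_le (by linarith) (by linarith)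
  calc _ = ((-1 : ℝ) ^ j) * ((-1 : ℝ) ^ j) * (sin s * cos s) := by ring
    _ ≤ 0 := by rw [this, one_mul]; exact mul_nonpos_of_nonneg_of_nonpos s1 s2

lemma mono_of_deriv {f f' : ℝ → ℝ} {X : ℝ} (h : ∀ x, X ≤ x → HasDerivAt f (f' x) x)
    (h' : ∀ x, X ≤ x → 0 ≤ f' x) : ∀ x y, X ≤ x → x ≤ y → f x ≤ f y := by
  intro x y hx hxy
  refine monotoneOn_of_deriv_nonneg (convex_Ici X)
    (fun z hz => (h z hz).continuousAt.continuousWithinAt) (fun z hz => ?_) (fun z hz => ?_)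
    (mem_Ici.2 hx) (mem_Ici.2 (hx.trans hxy)) hxy
  · rw [interior_Ici] at hz
    exact (h z (le_of_lt hz)).differentiableAt.differentiableWithinAt
  · rw [interior_Ici] at hz
    rw [(h z (le_of_lt hz)).deriv]
    exact h' z (le_of_lt hz)

lemma const_of_deriv {f : ℝ → ℝ} {X : ℝ} (h : ∀ x, X ≤ x → HasDerivAt f 0 x) :
    ∀ x, X ≤ x → f x = f X := by
  intro x hx
  refine constant_of_has_deriv_right_zero (a := X) (b := x)
    (fun z hz => (h z hz.1).continuousAt.continuousWithinAt)
    (fun z hz => (h z hz.1).hasDerivWithinAt) x ⟨hx, le_rfl⟩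

lemma IsP.shift {Q θ : ℝ → ℝ} (h : IsP Q θ) (j : ℤ) : IsP Q (fun x => θ x - j * π) := by
  intro x
  refine ((h x).sub_const (j * π)).congr_deriv ?_
  have e : ((-1 : ℝ) ^ j) ^ 2 = 1 := by
    rw [sq, ← mul_zpow]; norm_num
  rw [sin_sub_int_mul_pi, cos_sub_int_mul_pi, mul_pow, mul_pow, e]; ring

lemma strict_zero {Q Q' θ θ' : ℝ → ℝ} (h : IsP Q θ) (h' : IsP Q' θ') {X c : ℝ} (hc : 0 < c)
    (hQ : ∀ x, X ≤ x → Q' x + c ≤ Q x) (hle : ∀ x, X ≤ x → θ x ≤ θ' x)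
    (h1 : ∀ x, X ≤ x → π / 2 < θ x) (h2 : ∀ x, X ≤ x → θ' x < π) : False := by
  have hπ := pi_pos
  have sp : ∀ x, X ≤ x → 0 < sin (θ x) := fun x hx =>
    sin_pos_of_pos_of_lt_pi (by linarith [h1 x hx]) (by linarith [hle x hx, h2 x hx])
  have sp' : ∀ x, X ≤ x → 0 < sin (θ' x) := fun x hx =>
    sin_pos_of_pos_of_lt_pi (by linarith [h1 x hx, hle x hx]) (h2 x hx)
  have cp : ∀ x, X ≤ x → cos (θ x) ≤ 0 := fun x hx =>
    cos_nonpos_of_pi_div_two_le_of_le (h1 x hx).le (by linarith [hle x hx, h2 x hx])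
  let m : ℝ → ℝ := fun x => cos (θ x) / sin (θ x)
  let m' : ℝ → ℝ := fun x => cos (θ' x) / sin (θ' x)
  have hm : ∀ x, X ≤ x → HasDerivAt m (Q x - m x ^ 2) x := by
    intro x hx
    have hs := (sp x hx).ne'
    refine ((h x).cos.div (h x).sin hs).congr_deriv ?_
    have := sin_sq_add_cos_sq (θ x)
    simp only [m]
    field_simp
    linear_combination -(cos (θ x) ^ 2 - Q x * sin (θ x) ^ 2) * this
  have hm' : ∀ x, X ≤ x → HasDerivAt m' (Q' x - m' x ^ 2) x := by
    intro x hx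
    have hs := (sp' x hx).ne'
    refine ((h' x).cos.div (h' x).sin hs).congr_deriv ?_
    have := sin_sq_add_cos_sq (θ' x)
    simp only [m']
    field_simp
    linear_combination -(cos (θ' x) ^ 2 - Q' x * sin (θ' x) ^ 2) * this
  have m0 : ∀ x, X ≤ x → m x ≤ 0 := fun x hx =>
    div_nonpos_of_nonpos_of_nonneg (cp x hx) (sp x hx).le
  have mle : ∀ x, X ≤ x → m' x ≤ m x := by
    intro x hx
    simp only [m, m']
    rw [div_le_div_iff₀ (sp' x hx) (sp x hx)]
    have : 0 ≤ sin (θ' x - θ x) := sin_nonneg_of_nonneg_of_le_pi (by linarith [hle x hx])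
      (by linarith [h1 x hx, h2 x hx])
    rw [sin_sub] at this
    linarith
  set κ := min c 1 with hκ
  have κ0 : 0 < κ := lt_min hc one_pos
  have κ1 : κ ≤ 1 := min_le_right _ _
  have κc : κ ≤ c := min_le_left _ _
  have key := mono_of_deriv (f := fun x => arctan (m x - m' x) - κ * x)
    (f' := fun x => 1 / (1 + (m x - m' x) ^ 2) * ((Q x - m x ^ 2) - (Q' x - m' x ^ 2)) - κ * 1)
    (X := X)
    (fun x hx => (((hm x hx).sub (hm' x hx)).arctan).sub ((hasDerivAt_id x).const_mul κ))
    (fun x hx => by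
      have a1 := m0 x hx
      have a2 := mle x hx
      have a3 := hQ x hx
      have a4 : 0 < 1 + (m x - m' x) ^ 2 := by positivity
      rw [sub_nonneg, mul_one, one_div_mul_eq_div, le_div_iff₀ a4]
      have a5 : (m x - m' x) ^ 2 ≤ m' x ^ 2 - m x ^ 2 := by nlinarith
      nlinarith [sq_nonneg (m x - m' x)])
    X (X + π / κ) le_rfl (by have := div_pos hπ κ0; linarith)
  have e : κ * (X + π / κ) = κ * X + π := by field_simp
  simp only [e] at key
  have b1 := neg_pi_div_two_lt_arctan (m X - m' X)
  have b2 := arctan_lt_pi_div_two (m (X + π / κ) - m' (X + π / κ))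
  linarith

/-- strict comparison: if `θ` is stuck at level `j`, then `θ'` passes the next level. -/
lemma strict {Q Q' θ θ' : ℝ → ℝ} (hQc : Continuous Q) (h : IsP Q θ) (h' : IsP Q' θ') {X c : ℝ}
    (hX : 0 ≤ X) (hc : 0 < c)
    (hQ : ∀ x, 0 ≤ x → Q' x + c ≤ Q x) (hQ' : ∀ x, X ≤ x → 0 < Q' x) (h0 : θ 0 ≤ θ' 0) {j : ℤ}
    (hj : ∀ x, X ≤ x → j * π + π / 2 < θ x ∧ θ x < j * π + π) :
    ∃ x, X ≤ x ∧ (j + 1) * π < θ' x := by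
  by_contra hcon
  push Not at hcon
  have hle := compare hQc h h' (fun x hx => by linarith [hQ x hx]) h0
  obtain ⟨i, hi⟩ := stuck h' hQ' (fun x hx =>
    sincos_nonpos j (by linarith [(hj x hx).1, hle x (hX.trans hx)]) (by linarith [hcon x hx]))
  have hij : θ' X < j * π + π ∨ (j + 1) * π ≤ θ' X := by
    rcases lt_or_ge (θ' X) (j * π + π) with h | h
    · exact Or.inl h
    · exact Or.inr (by linarith)
  have hπ := pi_pos
  have hij : i = j := by
    have a := hi X le_rfl
    have b := hj X le_rfl
    have c := hle X hX
    have d := hcon X le_rfl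
    have e1 : (i : ℝ) < j + 1 := by
      by_contra hh; push Not at hh; nlinarith
    have e2 : (j : ℝ) < i + 1 := by
      by_contra hh; push Not at hh; nlinarith
    have e1 : i < j + 1 := by exact_mod_cast e1
    have e2 : j < i + 1 := by exact_mod_cast e2
    omega
  subst hij
  refine strict_zero (h.shift i) (h'.shift i) (X := X) hc (fun x hx => hQ x (hX.trans hx))
    (fun x hx => by linarith [hle x (hX.trans hx)]) (fun x hx => by linarith [(hj x hx).1])
    (fun x hx => by linarith [(hi x hx).2])

/-- low energies -/
lemma low {Q θ : ℝ → ℝ} (h : IsP Q θ) (h0 : π / 2 ≤ θ 0) (h1 : θ 0 < π)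
    (hQ : ∀ x, 0 ≤ x → 5 / sin (θ 0) ^ 2 ≤ Q x) : ∃ x, 0 ≤ x ∧ θ x < π / 2 := by
  by_contra hcon
  push Not at hcon
  have hπ := pi_pos
  have hs : 0 < sin (θ 0) := sin_pos_of_pos_of_lt_pi (by linarith) h1
  have hQ' : ∀ x, 0 ≤ x → 5 ≤ Q x * sin (θ 0) ^ 2 := by
    intro x hx
    have := hQ x hx
    rwa [div_le_iff₀ (by positivity)] at this
  have up : ∀ x, 0 ≤ x → θ x ≤ θ 0 := by
    intro x hx
    refine image_le_of_deriv_right_lt_deriv_boundary (f := θ)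
      (f' := fun x => cos (θ x) ^ 2 - Q x * sin (θ x) ^ 2)
      (B := fun _ => θ 0) (B' := fun _ => 0) (a := 0) (b := x) h.cont.continuousOn
      (fun y _ => (h y).hasDerivWithinAt) le_rfl (fun _ => hasDerivAt_const _ _)
      ?_ ⟨hx, le_rfl⟩
    intro y hy he
    have := hQ' y hy.1
    rw [he]
    have := cos_sq_le_one (θ 0)
    linarith
  have key := mono_of_deriv (f := fun x => -θ x - 4 * x) (X := 0)
    (f' := fun x => -(cos (θ x) ^ 2 - Q x * sin (θ x) ^ 2) - 4 * 1)
    (fun x hx => (h x).neg.sub ((hasDerivAt_id x).const_mul 4))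
    (fun x hx => by
      have a1 := hQ' x hx
      have a2 := cos_sq_le_one (θ x)
      have a3 : sin (θ 0) ≤ sin (θ x) := by
        have b1 : sin (θ 0) = sin (π - θ 0) := (sin_pi_sub _).symm
        have b2 : sin (θ x) = sin (π - θ x) := (sin_pi_sub _).symm
        rw [b1, b2]
        exact sin_le_sin_of_le_of_le_pi_div_two (by linarith) (by linarith [hcon x hx])
          (by linarith [up x hx])
      have a4 : sin (θ 0) ^ 2 ≤ sin (θ x) ^ 2 := by gcongr
      have a5 : 0 ≤ Q x := le_trans (by positivity) (hQ x hx)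
      nlinarith)
    0 1 le_rfl zero_le_one
  have := hcon 1 zero_le_one
  have := pi_lt_four
  linarith

/-- existence -/
lemma exist_level {W : ℝ → ℝ} (hc : Continuous W) (hmono : Monotone W) (h0W : ∀ x, 0 ≤ W x)
    (htop : ∀ C, ∃ x, 0 ≤ x ∧ C < W x) {Θ : ℝ → ℝ → ℝ}
    (h : ∀ E, IsP (fun x => W x - E) (Θ E)) (h0 : ∀ E, Θ E 0 = Θ 0 0) (hθ : Θ 0 0 < π)
    {E₁ x₁ : ℝ} (hx₁ : 0 ≤ x₁) {n m : ℤ} (hm : 0 ≤ m) (hmn : m ≤ n)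
    (hE₁ : (n + 1) * π < Θ E₁ x₁) :
    ∃ E, E < E₁ ∧ ∃ X, 0 ≤ X ∧ (∀ x, X ≤ x → 1 ≤ W x - E) ∧
      ∀ x, X ≤ x → m * π + π / 2 < Θ E x ∧ Θ E x < m * π + π := by
  have hπ := pi_pos
  have hm' : (0 : ℝ) ≤ m := by exact_mod_cast hm
  have hmn' : (m : ℝ) ≤ n := by exact_mod_cast hmn
  have hmπ : 0 ≤ m * π := by positivity
  have mono : ∀ E E', E ≤ E' → ∀ x, 0 ≤ x → Θ E x ≤ Θ E' x := by
    intro E E' hE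
    exact compare (Q := fun x => W x - E) (by fun_prop) (h E) (h E')
      (fun x _ => by linarith) (by rw [h0 E, h0 E'])
  let B : Set ℝ := {E | ∃ x, 0 ≤ x ∧ E + 1 < W x ∧ Θ E x < m * π + π / 2}
  have hBtrap : ∀ E ∈ B, ∃ x, 0 ≤ x ∧ ∀ y, x ≤ y → Θ E y ≤ m * π + π / 2 := by
    rintro E ⟨x, hx, hW, hlt⟩
    exact ⟨x, hx, upper_trap (h E) m (fun y hy => by linarith [hmono hy]) hlt.le⟩
  -- passing `(m+1)π` excludes membership in `B` for all larger energies
  have hBlt : ∀ E x, 0 ≤ x → (m + 1) * π < Θ E x → ∀ E' ∈ B, E' < E := by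
    intro E x hx hlt E' hE'
    by_contra hge
    push Not at hge
    obtain ⟨y, hy, ht⟩ := hBtrap E' hE'
    have a1 := mono E E' hge x hx
    have a2 := lower_trap (h E') (m + 1) (a := x) (by push_cast; linarith) (max x y)
      (le_max_left _ _)
    have a3 := ht (max x y) (le_max_right _ _)
    push_cast at a2
    linarith
  have hne : B.Nonempty := by
    rcases lt_or_ge (Θ 0 0) (π / 2) with hlt | hge
    · exact ⟨-2, 0, le_rfl, by linarith [h0W 0], by rw [h0]; linarith⟩
    · set E := -(5 / sin (Θ 0 0) ^ 2) - 2 with hE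
      have hE5 : 0 ≤ 5 / sin (Θ 0 0) ^ 2 := by positivity
      obtain ⟨x, hx, hlt⟩ := low (h E) (by rw [h0]; exact hge) (by rw [h0]; exact hθ)
        (fun x hx => by rw [h0]; linarith [h0W x])
      exact ⟨E, x, hx, by linarith [h0W x], by linarith⟩
  have hlt1 : (m + 1) * π < Θ E₁ x₁ := by nlinarith
  have hbdd : BddAbove B := ⟨E₁, fun E hE => (hBlt E₁ x₁ hx₁ hlt1 E hE).le⟩
  set S := sSup B with hS
  have hSnot : S ∉ B := by
    rintro ⟨x, hx, hW, hlt⟩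
    have hco := cont_energy hc h h0 hx
    have e1 : ∀ᶠ E in 𝓝 S, Θ E x < m * π + π / 2 := hco.continuousAt.eventually_lt_const hlt
    have e2 : ∀ᶠ E in 𝓝 S, E < W x - 1 := Iio_mem_nhds (by linarith)
    have e3 : ∀ᶠ E in 𝓝[>] S, Θ E x < m * π + π / 2 ∧ E < W x - 1 :=
      (e1.and e2).filter_mono nhdsWithin_le_nhds
    obtain ⟨E, ⟨hE1, hE2⟩, hE3⟩ := (e3.and self_mem_nhdsWithin).exists
    have hEB : E ∈ B := ⟨x, hx, by linarith, hE1⟩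
    exact absurd (le_csSup hbdd hEB) (not_le.2 hE3)
  obtain ⟨X, hX, hWX⟩ := htop (S + 1)
  have hW1 : ∀ x, X ≤ x → S + 1 < W x := fun x hx => lt_of_lt_of_le hWX (hmono hx)
  have lowb : ∀ x, X ≤ x → m * π + π / 2 ≤ Θ S x := by
    intro x hx
    by_contra hlt
    push Not at hlt
    exact hSnot ⟨x, hX.trans hx, hW1 x hx, hlt⟩
  have upb : ∀ x, 0 ≤ x → Θ S x ≤ (m + 1) * π := by
    intro x hx
    by_contra hlt
    push Not at hlt
    have hco := cont_energy hc h h0 hx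
    have e1 : ∀ᶠ E in 𝓝 S, (m + 1) * π < Θ E x := hco.continuousAt.eventually_const_lt hlt
    have e3 : ∀ᶠ E in 𝓝[<] S, (m + 1) * π < Θ E x := e1.filter_mono nhdsWithin_le_nhds
    obtain ⟨E, hE1, hE3⟩ := (e3.and self_mem_nhdsWithin).exists
    have : S ≤ E := csSup_le hne fun E' hE' => (hBlt E x hx hE1 E' hE').le
    exact absurd this (not_le.2 hE3)
  obtain ⟨j, hj⟩ := stuck (h S) (X := X) (fun x hx => by linarith [hW1 x hx])
    (fun x hx => sincos_nonpos m (lowb x hx) (by linarith [upb x (hX.trans hx)]))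
  have hjm : j = m := by
    have a := hj X le_rfl
    have b := lowb X le_rfl
    have d := upb X hX
    have e1 : (j : ℝ) < m + 1 := by
      by_contra hh; push Not at hh; nlinarith
    have e2 : (m : ℝ) < j + 1 := by
      by_contra hh; push Not at hh; nlinarith
    have e1 : j < m + 1 := by exact_mod_cast e1
    have e2 : m < j + 1 := by exact_mod_cast e2
    omega
  subst hjm
  refine ⟨S, ?_, X, hX, fun x hx => by linarith [hW1 x hx], hj⟩
  by_contra hge
  push Not at hge
  have := mono E₁ S hge x₁ hx₁
  have := upb x₁ hx₁
  linarith

lemma exists_r {Q θ : ℝ → ℝ} (hc : Continuous Q) (h : IsP Q θ) :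
    ∃ r : ℝ → ℝ, (∀ x, 0 < r x) ∧
      ∀ x, HasDerivAt r ((1 + Q x) * sin (θ x) * cos (θ x) * r x) x := by
  have hcθ := h.cont
  have hg : Continuous fun x => (1 + Q x) * sin (θ x) * cos (θ x) := by fun_prop
  refine ⟨fun x => exp (∫ t in (0 : ℝ)..x, (1 + Q t) * sin (θ t) * cos (θ t)),
    fun x => exp_pos _, fun x => ?_⟩
  exact (hg.integral_hasStrictDerivAt 0 x).hasDerivAt.exp.congr_deriv (mul_comm _ _)

lemma deriv_y {Q θ r : ℝ → ℝ} (h : IsP Q θ)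
    (hr : ∀ x, HasDerivAt r ((1 + Q x) * sin (θ x) * cos (θ x) * r x) x) (x : ℝ) :
    HasDerivAt (fun x => r x * sin (θ x)) (r x * cos (θ x)) x := by
  refine ((hr x).mul (h x).sin).congr_deriv ?_
  linear_combination (r x * cos (θ x)) * sin_sq_add_cos_sq (θ x)

lemma deriv_y' {Q θ r : ℝ → ℝ} (h : IsP Q θ)
    (hr : ∀ x, HasDerivAt r ((1 + Q x) * sin (θ x) * cos (θ x) * r x) x) (x : ℝ) :
    HasDerivAt (fun x => r x * cos (θ x)) (Q x * (r x * sin (θ x))) x := by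
  refine ((hr x).mul (h x).cos).congr_deriv ?_
  linear_combination (Q x * r x * sin (θ x)) * sin_sq_add_cos_sq (θ x)

lemma deriv_h {Q y z : ℝ → ℝ} {x : ℝ} (hy : HasDerivAt y (z x) x)
    (hz : HasDerivAt z (Q x * y x) x) :
    HasDerivAt (fun x => y x * z x) (z x ^ 2 + Q x * y x ^ 2) x := by
  refine (hy.mul hz).congr_deriv ?_
  ring

/-- if the product is nonpositive, the solution is square integrable -/
lemma integrable_of_nonpos {Q y z : ℝ → ℝ} {X : ℝ} (hy : ∀ x, HasDerivAt y (z x) x)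
    (hz : ∀ x, HasDerivAt z (Q x * y x) x) (hQ : ∀ x, X ≤ x → 1 ≤ Q x)
    (hs : ∀ x, X ≤ x → y x * z x ≤ 0) (hX : 0 ≤ X) :
    IntegrableOn (fun x => y x ^ 2) (Ici 0) := by
  have hcy : Continuous y := continuous_iff_continuousAt.2 fun x => (hy x).continuousAt
  have hc2 : Continuous fun x => y x ^ 2 := by fun_prop
  have h1 : IntegrableOn (fun x => y x ^ 2) (Ioi X) := by
    refine integrableOn_Ioi_of_intervalIntegral_norm_bounded (-(y X * z X)) X (b := fun t : ℝ => t)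
      (l := atTop) (fun i => (hc2.integrableOn_Icc).mono_set Ioc_subset_Icc_self) tendsto_id ?_
    filter_upwards [eventually_ge_atTop X] with b hb
    have e : ∀ x, ‖y x ^ 2‖ = y x ^ 2 := fun x => by
      rw [Real.norm_eq_abs, abs_of_nonneg (sq_nonneg _)]
    simp only [e]
    have key := mono_of_deriv (X := X)
      (f := fun b => y b * z b - ∫ x in X..b, y x ^ 2)
      (f' := fun x => (z x ^ 2 + Q x * y x ^ 2) - y x ^ 2)
      (fun x _ => (deriv_h (hy x) (hz x)).sub (hc2.integral_hasStrictDerivAt X x).hasDerivAt)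
      (fun x hx => by nlinarith [hQ x hx, sq_nonneg (y x), sq_nonneg (z x)]) X b le_rfl hb
    simp only [intervalIntegral.integral_same, sub_zero] at key
    linarith [hs b hb]
  have h2 : IntegrableOn (fun x => y x ^ 2) (Icc 0 X) := hc2.integrableOn_Icc
  have := h2.union h1
  rwa [Icc_union_Ioi_eq_Ici hX] at this

/-- square integrable solutions have nonpositive product -/
lemma nonpos_of_integrable {Q y z : ℝ → ℝ} {X : ℝ} (hX : 0 ≤ X)
    (hy : ∀ x, 0 ≤ x → HasDerivAt y (z x) x)
    (hz : ∀ x, 0 ≤ x → HasDerivAt z (Q x * y x) x) (hQ : ∀ x, X ≤ x → 0 ≤ Q x)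
    (hi : IntegrableOn (fun x => y x ^ 2) (Ici 0)) :
    ∀ x, X ≤ x → y x * z x ≤ 0 := by
  intro x₁ hx₁
  by_contra hpos
  push Not at hpos
  have m1 : ∀ x, x₁ ≤ x → y x₁ * z x₁ ≤ y x * z x := fun x hx =>
    mono_of_deriv (X := X) (fun x hx => deriv_h (hy x (hX.trans hx)) (hz x (hX.trans hx)))
      (fun x hx => add_nonneg (sq_nonneg _) (mul_nonneg (hQ x hx) (sq_nonneg _))) x₁ x hx₁ hx
  have m2 : ∀ x, x₁ ≤ x → y x₁ ^ 2 ≤ y x ^ 2 := fun x hx =>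
    mono_of_deriv (X := x₁) (f := fun x => y x ^ 2) (f' := fun x => 2 * (y x * z x))
      (fun x hx => ((hy x (hX.trans (hx₁.trans hx))).pow 2).congr_deriv (by norm_num; ring))
      (fun x hx => by linarith [m1 x hx]) x₁ x le_rfl hx
  have hy0 : y x₁ ≠ 0 := by
    rintro h; rw [h, zero_mul] at hpos; exact lt_irrefl _ hpos
  have hi' : IntegrableOn (fun x => y x ^ 2) (Ioi x₁) :=
    hi.mono_set fun x hx => mem_Ici.2 ((hX.trans hx₁).trans (le_of_lt hx))
  have hconst : IntegrableOn (fun _ : ℝ => y x₁ ^ 2) (Ioi x₁) := by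
    refine Integrable.mono' hi' aestronglyMeasurable_const ?_
    filter_upwards [ae_restrict_mem measurableSet_Ioi] with x hx
    rw [Real.norm_eq_abs, abs_of_nonneg (sq_nonneg _)]
    exact m2 x (le_of_lt hx)
  rw [integrableOn_const_iff] at hconst
  rcases hconst with h | h
  · exact hy0 (by simpa using h)
  · simp at h

/-- eigenfunction implies stuck -/
lemma stuck_of_eigen {Q θ f g : ℝ → ℝ} (hc : Continuous Q) (h : IsP Q θ) {X : ℝ} (hX : 0 ≤ X)
    (hQ : ∀ x, X ≤ x → 1 ≤ Q x)
    (hf : ∀ x, 0 ≤ x → HasDerivAt f (g x) x)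
    (hg : ∀ x, 0 ≤ x → HasDerivAt g (Q x * f x) x)
    (hi : IntegrableOn (fun x => f x ^ 2) (Ici 0))
    (hne : ∃ x, 0 ≤ x ∧ f x ≠ 0)
    (h0 : cos (θ 0) * f 0 - sin (θ 0) * g 0 = 0) :
    ∃ j : ℤ, ∀ x, X ≤ x → j * π + π / 2 < θ x ∧ θ x < j * π + π := by
  obtain ⟨r, rpos, hr⟩ := exists_r hc h
  have hw : ∀ x, 0 ≤ x → (f x * cos (θ x) - g x * sin (θ x)) * r x = 0 := by
    intro x hx
    have := const_of_deriv (X := 0) (f := fun x => (f x * cos (θ x) - g x * sin (θ x)) * r x)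
      (fun x hx => by
        refine ((((hf x hx).mul (h x).cos).sub ((hg x hx).mul (h x).sin)).mul (hr x)).congr_deriv ?_
        have e := sin_sq_add_cos_sq (θ x)
        simp only [Pi.mul_apply, Pi.sub_apply]
        rw [rhs_eq, ← sub_eq_zero]
        linear_combination (r x * (1 + Q x) * f x * sin (θ x)) * e) x hx
    rw [this]
    linear_combination r 0 * h0
  have hw' : ∀ x, 0 ≤ x → f x * cos (θ x) - g x * sin (θ x) = 0 := fun x hx =>
    (mul_eq_zero.1 (hw x hx)).resolve_right (rpos x).ne'
  set c := (f 0 * sin (θ 0) + g 0 * cos (θ 0)) / r 0 with hcdef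
  have hρ : ∀ x, 0 ≤ x → (f x * sin (θ x) + g x * cos (θ x)) / r x = c := by
    intro x hx
    exact const_of_deriv (X := 0) (f := fun x => (f x * sin (θ x) + g x * cos (θ x)) / r x)
      (fun x hx => by
        have hrx := (rpos x).ne'
        refine ((((hf x hx).mul (h x).sin).add ((hg x hx).mul (h x).cos)).div (hr x)
          hrx).congr_deriv ?_
        have e := sin_sq_add_cos_sq (θ x)
        have w := hw' x hx
        simp only [Pi.mul_apply, Pi.add_apply]
        rw [rhs_eq, div_eq_zero_iff]
        left
        linear_combination (r x * (1 + Q x) * (1 - 2 * sin (θ x) ^ 2)) * w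
          - (r x * (1 + Q x) * g x * sin (θ x)) * e) x hx
  have hfy : ∀ x, 0 ≤ x → f x = c * (r x * sin (θ x)) := by
    intro x hx
    have h1 := hρ x hx
    rw [div_eq_iff (rpos x).ne'] at h1
    linear_combination sin (θ x) * h1 + cos (θ x) * hw' x hx - f x * sin_sq_add_cos_sq (θ x)
  have hgy : ∀ x, 0 ≤ x → g x = c * (r x * cos (θ x)) := by
    intro x hx
    have h1 := hρ x hx
    rw [div_eq_iff (rpos x).ne'] at h1
    linear_combination cos (θ x) * h1 - sin (θ x) * hw' x hx - g x * sin_sq_add_cos_sq (θ x)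
  have hc0 : c ≠ 0 := by
    rintro hc0
    obtain ⟨x, hx, hfx⟩ := hne
    exact hfx (by rw [hfy x hx, hc0, zero_mul])
  refine stuck h (fun x hx => by linarith [hQ x hx]) fun x hx => ?_
  have := nonpos_of_integrable hX hf hg (fun x hx => by linarith [hQ x hx]) hi x hx
  rw [hfy x (hX.trans hx), hgy x (hX.trans hx)] at this
  have hp : 0 < (c * r x) ^ 2 := by have := (rpos x).ne'; positivity
  by_contra hpos
  push Not at hpos
  have := mul_pos hp hpos
  nlinarith

/-- stuck implies eigenfunction -/
lemma eigen_of_stuck {Q θ : ℝ → ℝ} (hc : Continuous Q) (h : IsP Q θ) {X : ℝ} (hX : 0 ≤ X)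
    (hQ : ∀ x, X ≤ x → 1 ≤ Q x) {j : ℤ}
    (hj : ∀ x, X ≤ x → j * π + π / 2 < θ x ∧ θ x < j * π + π) :
    ∃ f g : ℝ → ℝ, (∀ x, HasDerivAt f (g x) x) ∧ (∀ x, HasDerivAt g (Q x * f x) x) ∧
      IntegrableOn (fun x => f x ^ 2) (Ici 0) ∧ (∃ x, 0 ≤ x ∧ f x ≠ 0) ∧
      cos (θ 0) * f 0 - sin (θ 0) * g 0 = 0 := by
  obtain ⟨r, rpos, hr⟩ := exists_r hc h
  have hy := deriv_y h hr
  have hz := deriv_y' h hr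
  have hs : ∀ x, X ≤ x → (r x * sin (θ x)) * (r x * cos (θ x)) ≤ 0 := by
    intro x hx
    have := sincos_nonpos j (hj x hx).1.le (hj x hx).2.le
    have hp : 0 < r x ^ 2 := by have := rpos x; positivity
    nlinarith
  refine ⟨_, _, hy, hz, integrable_of_nonpos hy hz hQ hs hX, ⟨X, hX, ?_⟩, by ring⟩
  refine mul_ne_zero (rpos X).ne' ?_
  intro h0
  rw [sin_eq_zero_iff] at h0
  obtain ⟨n, hn⟩ := h0
  have hπ := pi_pos
  have a := hj X le_rfl
  rw [← hn] at a
  have e1 : (n : ℝ) < j + 1 := by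
    by_contra hh; push Not at hh; nlinarith
  have e2 : (j : ℝ) < n := by
    by_contra hh; push Not at hh; nlinarith
  have e1 : n < j + 1 := by exact_mod_cast e1
  have e2 : j < n := by exact_mod_cast e2
  omega

lemma integrable_shift (F : ℝ → ℝ) (u : ℝ) :
    IntegrableOn (fun x => F (x + u)) (Ici 0) ↔ IntegrableOn F (Ici u) := by
  have := (measurePreserving_add_right volume u).integrableOn_comp_preimage
    (measurableEmbedding_addRight u) (f := F) (s := Ici u)
  rw [← this]
  simp [Function.comp_def]

lemma morse_cont (k u : ℝ) : Continuous fun x => morse k (x + u) := by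
  unfold morse; fun_prop

lemma morse_nonneg {k : ℝ} (hk : 0 ≤ k) (u : ℝ) : 0 ≤ morse k u := by
  unfold morse; positivity

lemma morse_mono {k : ℝ} (hk : 0 ≤ k) : Monotone (morse k) := by
  intro a b hab
  unfold morse
  gcongr

lemma morse_top {k : ℝ} (hk : 0 ≤ k) (u C : ℝ) : ∃ x, 0 ≤ x ∧ C < morse k (x + u) := by
  refine ⟨max 0 (4 * |C| - u), le_max_left _ _, ?_⟩
  refine lt_of_lt_of_le ?_ (morse_mono hk (a := 4 * |C|) (by
    have := le_max_right 0 (4 * |C| - u); linarith))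
  unfold morse
  have h1 := add_one_le_exp (2 * (4 * |C|))
  have h2 : 0 ≤ k * exp (4 * |C|) := by positivity
  have := le_abs_self C
  have := abs_nonneg C
  linarith

lemma morse_gap {k : ℝ} (hk : 0 ≤ k) {u u' : ℝ} (hu : u < u') :
    ∃ c, 0 < c ∧ ∀ x, 0 ≤ x → morse k (x + u) + c ≤ morse k (x + u') := by
  refine ⟨(1/4) * (exp (2 * u') - exp (2 * u)), ?_, fun x hx => ?_⟩
  · have : exp (2 * u) < exp (2 * u') := exp_lt_exp.2 (by linarith)
    linarith
  · unfold morse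
    have h1 : exp (x + u) ≤ exp (x + u') := exp_le_exp.2 (by linarith)
    have h2 : exp (2 * u) < exp (2 * u') := exp_lt_exp.2 (by linarith)
    have h3 : 1 ≤ exp (2 * x) := one_le_exp (by linarith)
    have e1 : exp (2 * (x + u)) = exp (2 * x) * exp (2 * u) := by rw [← exp_add]; ring_nf
    have e2 : exp (2 * (x + u')) = exp (2 * x) * exp (2 * u') := by rw [← exp_add]; ring_nf
    rw [e1, e2]
    nlinarith [mul_le_mul_of_nonneg_left h1 hk]

lemma angle (α : ℝ) (h0 : 0 ≤ α) (h1 : α < 2 * π) : ∃ t, 0 ≤ t ∧ t < π ∧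
    ∀ a b : ℝ, cos α * a + sin α * b = 0 ↔ cos t * a - sin t * b = 0 := by
  have hπ := pi_pos
  rcases h0.eq_or_lt with h | h
  · subst h
    exact ⟨0, le_rfl, hπ, fun a b => by simp⟩
  rcases le_or_gt α π with h2 | h2
  · refine ⟨π - α, by linarith, by linarith, fun a b => ?_⟩
    rw [cos_pi_sub, sin_pi_sub]
    constructor <;> intro h <;> linarith
  · refine ⟨2 * π - α, by linarith, by linarith, fun a b => ?_⟩
    rw [cos_two_pi_sub, sin_two_pi_sub]
    constructor <;> intro h <;> linarith

section
variable {α k u t : ℝ}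

lemma mem_stuck (hk : 0 ≤ k)
    (ht : ∀ a b : ℝ, cos α * a + sin α * b = 0 ↔ cos t * a - sin t * b = 0)
    {E : ℝ} (hE : E ∈ evSet α u (morse k)) {θ : ℝ → ℝ}
    (h : IsP (fun x => morse k (x + u) - E) θ) (h0 : θ 0 = t) {X : ℝ} (hX : 0 ≤ X)
    (hQ : ∀ x, X ≤ x → 1 ≤ morse k (x + u) - E) :
    ∃ j : ℤ, ∀ x, X ≤ x → j * π + π / 2 < θ x ∧ θ x < j * π + π := by
  obtain ⟨ψ, hd, hd', ⟨v, hv, hne⟩, hi, hode, hbc⟩ := hE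
  refine stuck_of_eigen (Q := fun x => morse k (x + u) - E) (f := fun x => ψ (x + u))
    (g := fun x => deriv ψ (x + u)) ((morse_cont k u).sub continuous_const) h hX hQ
    (fun x _ => (hd (x + u)).hasDerivAt.comp_add_const x u)
    (fun x hx => ?_) ?_ ⟨v - u, by linarith, by simpa using hne⟩ ?_
  · refine ((hd' (x + u)).hasDerivAt.comp_add_const x u).congr_deriv ?_
    have := hode (x + u) (by linarith)
    linear_combination -this
  · exact (integrable_shift (fun x => ψ x ^ 2) u).2 hi
  · rw [h0]; simpa using (ht _ _).1 hbc

lemma stuck_mem 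
    (ht : ∀ a b : ℝ, cos α * a + sin α * b = 0 ↔ cos t * a - sin t * b = 0)
    {E : ℝ} {θ : ℝ → ℝ}
    (h : IsP (fun x => morse k (x + u) - E) θ) (h0 : θ 0 = t) {X : ℝ} (hX : 0 ≤ X)
    (hQ : ∀ x, X ≤ x → 1 ≤ morse k (x + u) - E) {j : ℤ}
    (hj : ∀ x, X ≤ x → j * π + π / 2 < θ x ∧ θ x < j * π + π) :
    E ∈ evSet α u (morse k) := by
  obtain ⟨f, g, hf, hg, hi, ⟨x, hx, hne⟩, hbc⟩ := eigen_of_stuck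
    ((morse_cont k u).sub continuous_const) h hX hQ hj
  have d1 : ∀ v, HasDerivAt (fun v => f (v - u)) (g (v - u)) v :=
    fun v => (hf (v - u)).comp_sub_const v u
  have e1 : deriv (fun v => f (v - u)) = fun v => g (v - u) := funext fun v => (d1 v).deriv
  have d2 : ∀ v, HasDerivAt (fun v => g (v - u)) ((morse k v - E) * f (v - u)) v := by
    intro v
    have := (hg (v - u)).comp_sub_const v u
    simpa using this
  have e2 : deriv (fun v => g (v - u)) = fun v => (morse k v - E) * f (v - u) :=
    funext fun v => (d2 v).deriv
  refine ⟨fun v => f (v - u), fun v => (d1 v).differentiableAt, ?_, ⟨x + u, by linarith, ?_⟩,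
    ?_, ?_, ?_⟩
  · rw [e1]; exact fun v => (d2 v).differentiableAt
  · simpa using hne
  · rw [← integrable_shift]; simpa using hi
  · intro v _
    rw [e1, e2]; ring
  · rw [e1, ht, ← h0]; simpa using hbc

end

theorem main (α k u₀ u₀' : ℝ) (hα0 : 0 ≤ α) (hα1 : α < 2 * Real.pi) (hk : 0 ≤ k)
    (hu : u₀ < u₀') (e e' : ℕ → ℝ) (he : StrictMono e) (he' : StrictMono e')
    (hre : Set.range e = evSet α u₀ (morse k))
    (hre' : Set.range e' = evSet α u₀' (morse k)) :
    ∀ n : ℕ, e n < e' n := by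
  obtain ⟨t, t0, tπ, ht⟩ := angle α hα0 hα1
  have hπ := pi_pos
  have hcW : ∀ u E, Continuous fun x => morse k (x + u) - E :=
    fun u E => (morse_cont k u).sub continuous_const
  choose Θ hΘ0 hΘ using fun E => exists_sol (hcW u₀ E) t
  choose Φ hΦ0 hΦ using fun E => exists_sol (hcW u₀' E) t
  have hbig : ∀ u C, ∃ X, 0 ≤ X ∧ ∀ x, X ≤ x → 1 ≤ morse k (x + u) - C := by
    intro u C
    obtain ⟨X, hX, h⟩ := morse_top hk u (C + 1)
    exact ⟨X, hX, fun x hx => by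
      have := morse_mono hk (a := X + u) (b := x + u) (by linarith)
      linarith⟩
  have hmem' : ∀ n, e' n ∈ evSet α u₀' (morse k) := fun n => hre' ▸ mem_range_self n
  -- indices of eigenvalues
  have hidx : ∀ n : ℕ, ∀ X, 0 ≤ X → (∀ x, X ≤ x → 1 ≤ morse k (x + u₀') - e' n) →
      ∃ j : ℤ, (n : ℤ) ≤ j ∧ ∀ x, X ≤ x →
        j * π + π / 2 < Φ (e' n) x ∧ Φ (e' n) x < j * π + π := by
    intro n
    induction n with
    | zero =>
      intro X hX hQ
      obtain ⟨j, hj⟩ := mem_stuck hk ht (hmem' 0) (hΦ _) (hΦ0 _) hX hQ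
      refine ⟨j, ?_, hj⟩
      have a := lower_trap (hΦ (e' 0)) 0 (a := 0) (by rw [hΦ0]; simpa using t0) X hX
      have b := (hj X le_rfl).2
      have : (0 : ℝ) < j + 1 := by
        by_contra hh; push Not at hh
        simp only [Int.cast_zero, zero_mul] at a
        nlinarith
      have : 0 < j + 1 := by exact_mod_cast this
      push_cast; omega
    | succ n ih =>
      intro X hX hQ
      have hlt : e' n < e' (n + 1) := he' (Nat.lt_succ_self n)
      obtain ⟨i, hi, hi'⟩ := ih X hX (fun x hx => by linarith [hQ x hx])
      obtain ⟨j, hj⟩ := mem_stuck hk ht (hmem' (n + 1)) (hΦ _) (hΦ0 _) hX hQ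
      refine ⟨j, ?_, hj⟩
      obtain ⟨x, hx, hgt⟩ := strict (hcW u₀' (e' n)) (hΦ (e' n)) (hΦ (e' (n + 1))) hX
        (c := e' (n + 1) - e' n) (by linarith) (fun x _ => by linarith)
        (fun x hx => by linarith [hQ x hx]) (by rw [hΦ0, hΦ0]) hi'
      have b := (hj x hx).2
      have : (i : ℝ) + 1 < j + 1 := by
        by_contra hh; push Not at hh
        nlinarith
      have : i + 1 < j + 1 := by exact_mod_cast this
      push_cast; omega
  intro n
  obtain ⟨c, hc, hgap⟩ := morse_gap hk hu
  obtain ⟨X, hX, hQ⟩ := hbig u₀ (e' n)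
  obtain ⟨j, hj, hj'⟩ := hidx n X hX (fun x hx => by linarith [hQ x hx, hgap x (hX.trans hx)])
  obtain ⟨x₁, hx₁, hgt⟩ := strict (hcW u₀' (e' n)) (hΦ (e' n)) (hΘ (e' n)) hX hc
    (fun x hx => by linarith [hgap x hx]) (fun x hx => by linarith [hQ x hx])
    (by rw [hΦ0, hΘ0]) hj'
  have hex : ∀ m : Fin (n + 1), ∃ i : ℕ, e i < e' n ∧ ∃ Y, ∀ x, Y ≤ x →
      ((m : ℕ) : ℝ) * π + π / 2 < Θ (e i) x ∧ Θ (e i) x < ((m : ℕ) : ℝ) * π + π := by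
    intro m
    have hm := m.2
    obtain ⟨E, hE, Y, hY, hW, hs⟩ := exist_level (W := fun x => morse k (x + u₀))
      (morse_cont k u₀) (fun a b hab => morse_mono hk (by linarith))
      (fun x => morse_nonneg hk _) (morse_top hk u₀) hΘ (fun E => by rw [hΘ0, hΘ0])
      (by rw [hΘ0]; exact tπ) (hX.trans hx₁) (n := j) (m := ((m : ℕ) : ℤ)) (by positivity)
      (by omega) hgt
    have hmem : E ∈ evSet α u₀ (morse k) := stuck_mem ht (hΘ E) (hΘ0 E) hY hW hs
    rw [← hre] at hmem
    obtain ⟨i, rfl⟩ := hmem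
    exact ⟨i, hE, Y, by simpa using hs⟩
  choose i hi Y hY using hex
  have hinj : Function.Injective i := by
    intro a b hab
    have h1 := hY a (max (Y a) (Y b)) (le_max_left _ _)
    have h2 := hY b (max (Y a) (Y b)) (le_max_right _ _)
    rw [← hab] at h2
    have e1 : ((a : ℕ) : ℝ) < (b : ℕ) + 1 := by
      by_contra hh; push Not at hh; nlinarith
    have e2 : ((b : ℕ) : ℝ) < (a : ℕ) + 1 := by
      by_contra hh; push Not at hh; nlinarith
    have e1 : (a : ℕ) < (b : ℕ) + 1 := by exact_mod_cast e1
    have e2 : (b : ℕ) < (a : ℕ) + 1 := by exact_mod_cast e2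
    exact Fin.ext (by omega)
  have hlarge : ∃ m, n ≤ i m := by
    by_contra hcon
    push Not at hcon
    have := Fintype.card_le_of_injective (fun m => (⟨i m, hcon m⟩ : Fin n))
      (fun a b hab => hinj (by simpa using hab))
    simp at this
  obtain ⟨m, hm⟩ := hlarge
  exact lt_of_le_of_lt (he.monotone hm) (hi m)

end Pruefer

/-- For `k ≥ 0`, each eigenvalue of the Morse potential on `[u₀,∞)` is a strictly
increasing function of the left endpoint `u₀`. -/
theorem stmt_5 (α k u₀ u₀' : ℝ) (hα0 : 0 ≤ α) (hα1 : α < 2 * Real.pi) (hk : 0 ≤ k)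
    (hu : u₀ < u₀') (e e' : ℕ → ℝ) (he : StrictMono e) (he' : StrictMono e')
    (hre : Set.range e = evSet α u₀ (morse k))
    (hre' : Set.range e' = evSet α u₀' (morse k)) :
    ∀ n : ℕ, e n < e' n :=
  Pruefer.main α k u₀ u₀' hα0 hα1 hk hu e e' he he' hre hre'
end

section
/- Fix a real α with 0 ≤ α < 2π and a real k < 0, and let u₀ < u₀' be real numbers with u₀ ≥ log(2|k|). Suppose e : ℕ → ℝ and e' : ℕ → ℝ are strictly increasing functions whose ranges are exactly S(α, u₀, V_k) and S(α, u₀', V_k) respectively. Then for every n, e(n) < e'(n). -/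
open Set Filter Topology MeasureTheory

/-- `θ` solves the Prüfer angle equation with coefficient `Q = 1 + V - E`. -/
def PSol (Q θ : ℝ → ℝ) : Prop := ∀ u, HasDerivAt θ (1 - Q u * Real.sin (θ u) ^ 2) u

lemma PSol.cont {Q θ : ℝ → ℝ} (h : PSol Q θ) : Continuous θ :=
  continuous_iff_continuousAt.2 fun u => (h u).continuousAt

lemma sin_eq_sinc (x : ℝ) : Real.sin x = Real.sinc x * x := by
  by_cases h : x = 0
  · simp [h]
  · rw [Real.sinc_of_ne_zero h]; field_simp

lemma sin_sq_sub (x y : ℝ) : Real.sin x ^ 2 - Real.sin y ^ 2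
    = Real.sin (x + y) * Real.sin (x - y) := by
  rw [Real.sin_add, Real.sin_sub]
  have h1 := Real.sin_sq_add_cos_sq x
  have h2 := Real.sin_sq_add_cos_sq y
  linear_combination (Real.sin y ^ 2) * h1 - (Real.sin x ^ 2) * h2

lemma lin_aux {k D g : ℝ → ℝ} {a b : ℝ} (hk : Continuous k)
    (hD : ∀ u ∈ Icc a b, HasDerivAt D (g u - k u * D u) u) :
    ∀ u ∈ Icc a b, HasDerivAt (fun u => Real.exp (∫ s in a..u, k s) * D u)
      (Real.exp (∫ s in a..u, k s) * g u) u := by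
  intro u hu
  have h1 : HasDerivAt (fun u => ∫ s in a..u, k s) (k u) u :=
    intervalIntegral.integral_hasDerivAt_right (hk.intervalIntegrable _ _)
      (hk.stronglyMeasurableAtFilter _ _) hk.continuousAt
  have h2 := h1.exp.mul (hD u hu)
  refine h2.congr_deriv ?_
  ring

lemma lin_mono {k D g : ℝ → ℝ} {a b : ℝ} (hab : a ≤ b) (hk : Continuous k)
    (hD : ∀ u ∈ Icc a b, HasDerivAt D (g u - k u * D u) u) (hg : ∀ u ∈ Ioo a b, 0 ≤ g u) :
    ∃ c > 0, D a ≤ c * D b := by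
  have h := lin_aux hk hD
  have hm : MonotoneOn (fun u => Real.exp (∫ s in a..u, k s) * D u) (Icc a b) := by
    apply monotoneOn_of_deriv_nonneg (convex_Icc a b)
    · exact fun u hu => (h u hu).continuousAt.continuousWithinAt
    · intro u hu
      rw [interior_Icc] at hu
      exact (h u (Ioo_subset_Icc_self hu)).differentiableAt.differentiableWithinAt
    · intro u hu
      rw [interior_Icc] at hu
      rw [(h u (Ioo_subset_Icc_self hu)).deriv]
      exact mul_nonneg (Real.exp_pos _).le (hg u hu)
  have := hm (left_mem_Icc.2 hab) (right_mem_Icc.2 hab) hab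
  refine ⟨_, Real.exp_pos (∫ s in a..b, k s), ?_⟩
  simpa using this

lemma lin_nonneg {k D g : ℝ → ℝ} {a b : ℝ} (hab : a ≤ b) (hk : Continuous k)
    (hD : ∀ u ∈ Icc a b, HasDerivAt D (g u - k u * D u) u) (hg : ∀ u ∈ Ioo a b, 0 ≤ g u)
    (h0 : 0 ≤ D a) : 0 ≤ D b := by
  obtain ⟨c, hc, h⟩ := lin_mono hab hk hD hg
  exact nonneg_of_mul_nonneg_right (h0.trans h) hc

lemma lin_pos0 {k D g : ℝ → ℝ} {a b : ℝ} (hab : a ≤ b) (hk : Continuous k)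
    (hD : ∀ u ∈ Icc a b, HasDerivAt D (g u - k u * D u) u) (hg : ∀ u ∈ Ioo a b, 0 ≤ g u)
    (h0 : 0 < D a) : 0 < D b := by
  obtain ⟨c, hc, h⟩ := lin_mono hab hk hD hg
  exact pos_of_mul_pos_right (h0.trans_le h) hc.le

lemma lin_pos {k D g : ℝ → ℝ} {a b : ℝ} (hab : a < b) (hk : Continuous k)
    (hD : ∀ u ∈ Icc a b, HasDerivAt D (g u - k u * D u) u) (hg : ∀ u ∈ Ioo a b, 0 < g u)
    (h0 : 0 ≤ D a) : 0 < D b := by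
  have h := lin_aux hk hD
  have hm : StrictMonoOn (fun u => Real.exp (∫ s in a..u, k s) * D u) (Icc a b) := by
    apply strictMonoOn_of_deriv_pos (convex_Icc a b)
    · exact fun u hu => (h u hu).continuousAt.continuousWithinAt
    · intro u hu
      rw [interior_Icc] at hu
      rw [(h u (Ioo_subset_Icc_self hu)).deriv]
      exact mul_pos (Real.exp_pos _) (hg u hu)
  have := hm (left_mem_Icc.2 hab.le) (right_mem_Icc.2 hab.le) hab
  simp only [intervalIntegral.integral_same, Real.exp_zero, one_mul] at this
  exact pos_of_mul_pos_right (h0.trans_lt this) (Real.exp_pos _).le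

lemma lin_zero {k D : ℝ → ℝ} {a b : ℝ} (hab : a ≤ b) (hk : Continuous k)
    (hD : ∀ u ∈ Icc a b, HasDerivAt D (- k u * D u) u)
    (h0 : D a = 0) : D b = 0 := by
  apply le_antisymm
  · have := lin_nonneg (D := fun u => - D u) (g := fun _ => 0) hab hk
      (fun u hu => (hD u hu).neg.congr_deriv (by ring)) (fun _ _ => le_rfl) (by simp [h0])
    linarith
  · exact lin_nonneg (g := fun _ => 0) hab hk
      (fun u hu => (hD u hu).congr_deriv (by ring)) (fun _ _ => le_rfl) (by simp [h0])

lemma lin_ne {k D : ℝ → ℝ} {a b : ℝ} (hab : a ≤ b) (hk : Continuous k)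
    (hD : ∀ u ∈ Icc a b, HasDerivAt D (- k u * D u) u)
    (h0 : D a ≠ 0) : D b ≠ 0 := by
  rcases lt_or_gt_of_ne h0 with h | h
  · have := lin_pos0 (D := fun u => - D u) (g := fun _ => 0) hab hk
      (fun u hu => (hD u hu).neg.congr_deriv (by ring)) (fun _ _ => le_rfl) (by simpa using h)
    intro h'
    simp [h'] at this
  · exact ne_of_gt (lin_pos0 (g := fun _ => 0) hab hk
      (fun u hu => (hD u hu).congr_deriv (by ring)) (fun _ _ => le_rfl) h)

/-- Lower barrier at multiples of `π`. -/
lemma barrier_low {Q θ : ℝ → ℝ} (hQ : Continuous Q) (h : PSol Q θ) (p : ℤ) {a b : ℝ}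
    (hab : a < b) (h0 : p * Real.pi ≤ θ a) : p * Real.pi < θ b := by
  have hc := h.cont
  have := lin_pos (D := fun u => θ u - p * Real.pi) (g := fun _ => 1)
    (k := fun u => Q u * Real.sin (θ u - p * Real.pi) * Real.sinc (θ u - p * Real.pi)) hab
    (by have := Real.continuous_sinc; fun_prop)
    (fun u _ => by
      refine HasDerivAt.congr_deriv ((h u).sub_const (p * Real.pi)) ?_
      have e : Real.sin (θ u) ^ 2 = Real.sin (θ u - p * Real.pi) ^ 2 := by
        rw [Real.sin_sub_int_mul_pi, mul_pow]
        have : ((-1 : ℝ) ^ p) ^ 2 = 1 := by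
          rw [← zpow_natCast, ← zpow_mul, mul_comm, zpow_mul]; norm_num
        rw [this, one_mul]
      rw [e]
      linear_combination (-Q u * Real.sin (θ u - p * Real.pi)) * sin_eq_sinc (θ u - p * Real.pi))
    (fun _ _ => one_pos) (by linarith)
  linarith

/-- Upper barrier at an angle `γ` where the vector field is negative. -/
lemma barrier_up {Q θ : ℝ → ℝ} (hQ : Continuous Q) (h : PSol Q θ) (γ : ℝ) {a b : ℝ}
    (hab : a < b) (hγ : ∀ u ∈ Ioo a b, 1 < Q u * Real.sin γ ^ 2) (h0 : θ a ≤ γ) : θ b < γ := by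
  have hc := h.cont
  have := lin_pos (D := fun u => γ - θ u) (g := fun u => Q u * Real.sin γ ^ 2 - 1)
    (k := fun u => Q u * Real.sin (γ + θ u) * Real.sinc (γ - θ u)) hab
    (by have := Real.continuous_sinc; fun_prop)
    (fun u _ => by
      refine HasDerivAt.congr_deriv ((h u).const_sub γ) ?_
      linear_combination (-1) * Q u * sin_sq_sub γ (θ u)
        - (Q u * Real.sin (γ + θ u)) * sin_eq_sinc (γ - θ u))
    (fun u hu => by have := hγ u hu; linarith) (by linarith)
  linarith

/-- Strict Sturm comparison for angles. -/
lemma compare {Q₁ Q₂ θ₁ θ₂ : ℝ → ℝ} (hQ₂ : Continuous Q₂)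
    (h₁ : PSol Q₁ θ₁) (h₂ : PSol Q₂ θ₂)
    {a b : ℝ} (hab : a < b) (hlt : ∀ u, a ≤ u → Q₁ u < Q₂ u) (h0 : θ₂ a ≤ θ₁ a) :
    θ₂ b < θ₁ b := by
  have hc₁ := h₁.cont
  have hc₂ := h₂.cont
  have hder : ∀ u, HasDerivAt (fun u => θ₁ u - θ₂ u)
      ((Q₂ u - Q₁ u) * Real.sin (θ₁ u) ^ 2 -
        (Q₂ u * Real.sin (θ₁ u + θ₂ u) * Real.sinc (θ₁ u - θ₂ u)) * (θ₁ u - θ₂ u)) u := by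
    intro u
    refine HasDerivAt.congr_deriv ((h₁ u).sub (h₂ u)) ?_
    linear_combination (-1) * Q₂ u * sin_sq_sub (θ₁ u) (θ₂ u)
        - (Q₂ u * Real.sin (θ₁ u + θ₂ u)) * sin_eq_sinc (θ₁ u - θ₂ u)
  have hk : Continuous
      (fun u => Q₂ u * Real.sin (θ₁ u + θ₂ u) * Real.sinc (θ₁ u - θ₂ u)) := by
    have := Real.continuous_sinc; fun_prop
  -- find a point where `sin θ₁` does not vanish
  have hex : ∃ c ∈ Ioo a b, 0 < Real.sin (θ₁ c) ^ 2 := by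
    by_contra hcon
    push Not at hcon
    have hs : ∀ c ∈ Ioo a b, Real.sin (θ₁ c) = 0 := by
      intro c hc
      have := hcon c hc
      have h3 := sq_nonneg (Real.sin (θ₁ c))
      exact pow_eq_zero_iff (two_ne_zero) |>.1 (le_antisymm this h3)
    have hm : (a + b) / 2 ∈ Ioo a b := ⟨by linarith, by linarith⟩
    have hd := (h₁ ((a+b)/2)).sin
    have hev : (fun u => Real.sin (θ₁ u)) =ᶠ[𝓝 ((a+b)/2)] fun _ => 0 := by
      filter_upwards [Ioo_mem_nhds hm.1 hm.2] with u hu using hs u hu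
    have h4 := hd.unique ((hasDerivAt_const _ (0:ℝ)).congr_of_eventuallyEq hev)
    have h5 := hs _ hm
    have h6 := Real.sin_sq_add_cos_sq (θ₁ ((a+b)/2))
    rw [h5] at h4 h6
    norm_num at h4 h6
    rw [h4] at h6; norm_num at h6
  obtain ⟨c, hc, hpos⟩ := hex
  -- weak inequality
  have hw : ∀ u, a ≤ u → 0 ≤ θ₁ u - θ₂ u := by
    intro u hu
    refine lin_nonneg (D := fun u => θ₁ u - θ₂ u) hu hk (fun u _ => hder u) ?_ (by linarith)
    intro v hv
    exact mul_nonneg (by have := hlt v hv.1.le; linarith) (sq_nonneg _)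
  -- near c strict
  have hev : ∀ᶠ u in 𝓝 c, 0 < Real.sin (θ₁ u) ^ 2 :=
    ((by fun_prop : Continuous fun u => Real.sin (θ₁ u) ^ 2).continuousAt).eventually
      (lt_mem_nhds hpos)
  obtain ⟨d, hd1, hd2⟩ := (hev.and (Ioo_mem_nhds hc.1 hc.2)).filter_mono
      (nhdsWithin_le_nhds (s := Ioi c)) |> fun h => (mem_nhdsGT_iff_exists_Ioo_subset).1 h
  have hcd : c < d := hd1
  have hsd : 0 < θ₁ ((c+d)/2) - θ₂ ((c+d)/2) := by
    refine lin_pos (D := fun u => θ₁ u - θ₂ u) (a := c) (by linarith) hk (fun u _ => hder u) ?_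
      (hw c hc.1.le)
    intro v hv
    have h7 := hd2 (show v ∈ Ioo c d from ⟨hv.1, by linarith [hv.2]⟩)
    exact mul_pos (by have := hlt v (hc.1.trans hv.1).le; linarith) h7.1
  have h8 := (hd2 (show (c+d)/2 ∈ Ioo c d from ⟨by linarith, by linarith⟩)).2
  have := lin_pos0 (D := fun u => θ₁ u - θ₂ u) h8.2.le hk (fun u _ => hder u) ?_ hsd
  · linarith
  intro v hv
  exact mul_nonneg (by have := hlt v (h8.1.trans hv.1).le; linarith) (sq_nonneg _)

lemma abs_sin_sq_sub_le (x y : ℝ) : |Real.sin x ^ 2 - Real.sin y ^ 2| ≤ |x - y| := by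
  rw [sin_sq_sub, abs_mul]
  calc |Real.sin (x + y)| * |Real.sin (x - y)| ≤ 1 * |x - y| :=
        mul_le_mul (Real.abs_sin_le_one _) Real.abs_sin_le_abs (abs_nonneg _) zero_le_one
    _ = _ := one_mul _

lemma bound_Icc {Q : ℝ → ℝ} (hQ : Continuous Q) (a b : ℝ) :
    ∃ M : NNReal, ∀ u ∈ Icc a b, |Q u| ≤ M := by
  obtain ⟨C, hC⟩ := isCompact_Icc.exists_bound_of_continuousOn (s := Icc a b) hQ.continuousOn
  refine ⟨Real.toNNReal C, fun u hu => (hC u hu).trans (Real.le_coe_toNNReal C)⟩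

lemma lip_field {Q : ℝ → ℝ} {M : NNReal} {u : ℝ} (h : |Q u| ≤ M) (s : Set ℝ) :
    LipschitzOnWith M (fun x => 1 - Q u * Real.sin x ^ 2) s := by
  apply LipschitzOnWith.of_dist_le_mul
  intro x _ y _
  rw [Real.dist_eq, Real.dist_eq]
  have : 1 - Q u * Real.sin x ^ 2 - (1 - Q u * Real.sin y ^ 2)
    = - (Q u * (Real.sin x ^ 2 - Real.sin y ^ 2)) := by ring
  rw [this, abs_neg, abs_mul]
  exact mul_le_mul h (abs_sin_sq_sub_le _ _) (abs_nonneg _) M.2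

lemma exists_local {Q : ℝ → ℝ} (hQ : Continuous Q) (a β : ℝ) (n : ℕ) :
    ∃ θ : ℝ → ℝ, θ a = β ∧ ∀ u ∈ Ioo (a - (n + 1)) (a + (n + 1)),
      HasDerivAt θ (1 - Q u * Real.sin (θ u) ^ 2) u := by
  obtain ⟨M, hM⟩ := bound_Icc hQ (a - (n + 1)) (a + (n + 1))
  have hn : (0 : ℝ) ≤ n := Nat.cast_nonneg n
  have hpl : IsPicardLindelof (fun u x => 1 - Q u * Real.sin x ^ 2)
      (tmin := a - (n + 1)) (tmax := a + (n + 1))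
      ⟨a, by constructor <;> linarith⟩ β ((1 + M) * (n + 1)) 0 (1 + M) M := by
    refine ⟨fun t ht => lip_field (hM t ht) _, fun x _ => by fun_prop, ?_, ?_⟩
    · intro t ht x _
      rw [Real.norm_eq_abs]
      have h1 := hM t ht
      have h2 : |Real.sin x ^ 2| ≤ 1 := by
        rw [abs_pow]; exact pow_le_one₀ (abs_nonneg _) (Real.abs_sin_le_one x)
      calc |1 - Q t * Real.sin x ^ 2| ≤ |(1:ℝ)| + |Q t * Real.sin x ^ 2| := abs_sub _ _
        _ ≤ 1 + M * 1 := by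
            rw [abs_one, abs_mul]
            have := mul_le_mul h1 h2 (abs_nonneg _) M.2
            linarith
        _ = ((1 + M : NNReal) : ℝ) := by push_cast; ring
    · simp
  obtain ⟨θ, h0, hθ⟩ := hpl.exists_eq_forall_mem_Icc_hasDerivWithinAt₀
  refine ⟨θ, h0, fun u hu => ?_⟩
  exact (hθ u (Ioo_subset_Icc_self hu)).hasDerivAt (Icc_mem_nhds hu.1 hu.2)

lemma exists_psol {Q : ℝ → ℝ} (hQ : Continuous Q) (a β : ℝ) :
    ∃ θ : ℝ → ℝ, θ a = β ∧ PSol Q θ := by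
  choose Θ h0 hΘ using exists_local hQ a β
  have huniq : ∀ m n, m ≤ n → EqOn (Θ m) (Θ n) (Ioo (a - ((m:ℝ) + 1)) (a + ((m:ℝ) + 1))) := by
    intro m n hmn
    obtain ⟨M, hM⟩ := bound_Icc hQ (a - (m + 1)) (a + (m + 1))
    have hm : (0 : ℝ) ≤ m := Nat.cast_nonneg m
    have hmn' : (m : ℝ) ≤ n := by exact_mod_cast hmn
    refine ODE_solution_unique_of_mem_Ioo (t₀ := a) (s := fun _ => univ) (K := M)
      (v := fun u x => 1 - Q u * Real.sin x ^ 2)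
      (fun t ht => lip_field (hM t (Ioo_subset_Icc_self ht)) _)
      ⟨by linarith, by linarith⟩ (fun t ht => ⟨hΘ m t ht, mem_univ _⟩)
      (fun t ht => ⟨hΘ n t ⟨by linarith [ht.1], by linarith [ht.2]⟩, mem_univ _⟩) ?_
    rw [h0, h0]
  have hmem : ∀ (u : ℝ) (n : ℕ), |u - a| < n + 1 →
      u ∈ Ioo (a - ((n:ℝ) + 1)) (a + ((n:ℝ) + 1)) := by
    intro u n h
    rw [abs_lt] at h
    exact ⟨by linarith, by linarith⟩
  have hceil : ∀ u : ℝ, |u - a| < (⌈|u - a|⌉₊ : ℝ) + 1 := fun u =>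
    (Nat.le_ceil _).trans_lt (lt_add_one _)
  refine ⟨fun u => Θ ⌈|u - a|⌉₊ u, by simp [h0], fun u => ?_⟩
  set N := ⌈|u - a|⌉₊ with hN
  have hu := hmem u N (hceil u)
  have hev : (fun v => Θ ⌈|v - a|⌉₊ v) =ᶠ[𝓝 u] Θ N := by
    filter_upwards [Ioo_mem_nhds hu.1 hu.2] with v hv
    rcases le_total N ⌈|v - a|⌉₊ with h | h
    · exact (huniq _ _ h hv).symm
    · exact huniq _ _ h (hmem v _ (hceil v))
  exact ((hΘ N u hu).congr_of_eventuallyEq hev).congr_deriv (by simp [← hN])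

/-- Continuous dependence of the angle on the energy. -/
lemma cont_energy {V : ℝ → ℝ} (hV : Continuous V) {a b : ℝ} (hab : a ≤ b) (β : ℝ)
    {θ : ℝ → ℝ → ℝ} (hθ : ∀ E, PSol (fun u => 1 + V u - E) (θ E)) (h0 : ∀ E, θ E a = β) :
    Continuous fun E => θ E b := by
  rw [continuous_iff_continuousAt]
  intro E
  obtain ⟨M, hM⟩ := bound_Icc (Q := fun u => 1 + V u - E) (by fun_prop) a b
  have key : ∀ E', |θ E' b - θ E b| ≤ gronwallBound 0 M |E' - E| (b - a) := by
    intro E'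
    have := norm_le_gronwallBound_of_norm_deriv_right_le (f := fun u => θ E' u - θ E u)
      (f' := fun u => (1 - (1 + V u - E') * Real.sin (θ E' u) ^ 2)
        - (1 - (1 + V u - E) * Real.sin (θ E u) ^ 2)) (δ := 0) (K := M) (ε := |E' - E|)
      (a := a) (b := b) ((hθ E').cont.sub (hθ E).cont).continuousOn
      (fun u _ => ((hθ E' u).sub (hθ E u)).hasDerivWithinAt) (by simp [h0]) ?_ b ⟨hab, le_rfl⟩
    · simpa using this
    intro u hu
    have e : (1 - (1 + V u - E') * Real.sin (θ E' u) ^ 2)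
        - (1 - (1 + V u - E) * Real.sin (θ E u) ^ 2)
        = -((1 + V u - E) * (Real.sin (θ E' u) ^ 2 - Real.sin (θ E u) ^ 2))
          + (E' - E) * Real.sin (θ E' u) ^ 2 := by ring
    rw [e, Real.norm_eq_abs, Real.norm_eq_abs]
    refine (abs_add_le _ _).trans ?_
    rw [abs_neg, abs_mul, abs_mul]
    apply add_le_add
    · exact mul_le_mul (hM u (Ico_subset_Icc_self hu)) (abs_sin_sq_sub_le _ _) (abs_nonneg _) M.2
    · have h2 : |Real.sin (θ E' u) ^ 2| ≤ 1 := by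
        rw [abs_pow]; exact pow_le_one₀ (abs_nonneg _) (Real.abs_sin_le_one _)
      exact mul_le_of_le_one_right (abs_nonneg _) h2
  have hlim : Tendsto (fun E' => gronwallBound 0 M |E' - E| (b - a)) (𝓝 E) (𝓝 0) := by
    have hc : Continuous fun E' => gronwallBound 0 M |E' - E| (b - a) :=
      (gronwallBound_continuous_ε 0 M (b - a)).comp (by fun_prop : Continuous fun E' => |E' - E|)
    have := hc.tendsto E
    simpa [gronwallBound_ε0_δ0] using this
  rw [ContinuousAt, tendsto_iff_dist_tendsto_zero]
  exact squeeze_zero (fun _ => dist_nonneg) (fun E' => by rw [Real.dist_eq]; exact key E') hlim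

/-- `θ` is eventually in the open quadrant `(pπ - π/2, pπ)` (decaying solution). -/
def Tail (θ : ℝ → ℝ) (p : ℤ) : Prop :=
  ∃ U, ∀ u, U ≤ u → p * Real.pi - Real.pi / 2 < θ u ∧ θ u < p * Real.pi

lemma sin_sub_pi {x : ℝ} {p : ℤ} (h1 : p * Real.pi - Real.pi / 2 < x) (h2 : x < p * Real.pi) :
    Real.sin x ≠ 0 ∧ Real.sin x * Real.cos x < 0 := by
  have hs : Real.sin (2 * x) < 0 := by
    have e : Real.sin (2 * x) = Real.sin (2 * x - p * (2 * Real.pi)) :=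
      (Real.sin_sub_int_mul_two_pi _ _).symm
    rw [e]
    apply Real.sin_neg_of_neg_of_neg_pi_lt <;> linarith
  rw [Real.sin_two_mul] at hs
  have : Real.sin x * Real.cos x < 0 := by linarith
  refine ⟨fun h => ?_, this⟩
  rw [h] at this; simp at this

lemma blowup {δ δ' : ℝ → ℝ} {U : ℝ} (hd : ∀ u, U ≤ u → HasDerivAt δ (δ' u) u)
    (hpos : ∀ u, U ≤ u → 0 < δ u) (hge : ∀ u, U ≤ u → δ u ^ 2 ≤ δ' u) : False := by
  have hm : MonotoneOn (fun u => - (δ u)⁻¹ - u) (Ici U) := by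
    have hder : ∀ u, U ≤ u → HasDerivAt (fun u => - (δ u)⁻¹ - u) (δ' u / δ u ^ 2 - 1) u := by
      intro u hu
      have := (((hd u hu).inv (hpos u hu).ne').neg).sub (hasDerivAt_id u)
      exact this.congr_deriv (by ring)
    apply monotoneOn_of_deriv_nonneg (convex_Ici U)
    · exact fun u hu => (hder u hu).continuousAt.continuousWithinAt
    · intro u hu
      rw [interior_Ici] at hu
      exact (hder u (le_of_lt hu)).differentiableAt.differentiableWithinAt
    · intro u hu
      rw [interior_Ici] at hu
      have hu : U ≤ u := le_of_lt hu
      rw [(hder u hu).deriv, sub_nonneg, le_div_iff₀ (pow_pos (hpos u hu) 2), one_mul]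
      exact hge u hu
  have hi : 0 < (δ U)⁻¹ := inv_pos.2 (hpos U le_rfl)
  have h1 : U ≤ U + (δ U)⁻¹ := by linarith
  have h := hm (mem_Ici.2 le_rfl) (mem_Ici.2 h1) h1
  have h2 : 0 < (δ (U + (δ U)⁻¹))⁻¹ := inv_pos.2 (hpos _ h1)
  simp only at h
  linarith

lemma hasDerivAt_cot_psol {Q θ : ℝ → ℝ} (h : PSol Q θ) {u : ℝ} (hs : Real.sin (θ u) ≠ 0) :
    HasDerivAt (fun u => Real.cos (θ u) / Real.sin (θ u))
      (Q u - 1 - (Real.cos (θ u) / Real.sin (θ u)) ^ 2) u := by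
  refine ((h u).cos.div (h u).sin hs).congr_deriv ?_
  have := Real.sin_sq_add_cos_sq (θ u)
  field_simp
  linear_combination ((Q u) * Real.sin (θ u) ^ 2) * this

/-- Strictness: a strictly smaller coefficient pushes the angle past the decaying one. -/
lemma strict_tail {Q₁ Q₂ θ₁ θ₂ : ℝ → ℝ} (hQ₁ : Continuous Q₁) (hQ₂ : Continuous Q₂)
    (h₁ : PSol Q₁ θ₁) (h₂ : PSol Q₂ θ₂)
    {a : ℝ} (hlt : ∀ u, a ≤ u → Q₁ u < Q₂ u) (h0 : θ₂ a ≤ θ₁ a) {p : ℤ} (hp : Tail θ₂ p) :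
    ∃ u, a ≤ u ∧ p * Real.pi < θ₁ u := by
  by_contra hcon
  push Not at hcon
  obtain ⟨U₀, hU₀⟩ := hp
  set U := max U₀ (a + 1) with hU
  have hUa : a + 1 ≤ U := le_max_right _ _
  have hUU : U₀ ≤ U := le_max_left _ _
  have hgt : ∀ u, U ≤ u → θ₂ u < θ₁ u := fun u hu =>
    compare hQ₂ h₁ h₂ (by linarith) hlt h0
  have hlt1 : ∀ u, U ≤ u → θ₁ u < p * Real.pi := by
    intro u hu
    by_contra hc
    push Not at hc
    have := barrier_low hQ₁ h₁ p (lt_add_one u) hc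
    exact absurd (hcon (u + 1) (by linarith)) (not_le.2 this)
  have hT1 : ∀ u, U ≤ u → Real.sin (θ₁ u) ≠ 0 ∧ Real.sin (θ₁ u) * Real.cos (θ₁ u) < 0 :=
    fun u hu => sin_sub_pi ((hU₀ u (hUU.trans hu)).1.trans (hgt u hu)) (hlt1 u hu)
  have hT2 : ∀ u, U ≤ u → Real.sin (θ₂ u) ≠ 0 ∧ Real.sin (θ₂ u) * Real.cos (θ₂ u) < 0 :=
    fun u hu => sin_sub_pi (hU₀ u (hUU.trans hu)).1 (hU₀ u (hUU.trans hu)).2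
  have hneg : ∀ x : ℝ, Real.sin x ≠ 0 → Real.sin x * Real.cos x < 0 →
      Real.cos x / Real.sin x < 0 := by
    intro x hx h
    have : Real.cos x / Real.sin x = (Real.sin x * Real.cos x) / Real.sin x ^ 2 := by
      field_simp
    rw [this]
    exact div_neg_of_neg_of_pos h (by positivity)
  have hpos : ∀ u, U ≤ u → 0 < Real.cos (θ₂ u) / Real.sin (θ₂ u)
      - Real.cos (θ₁ u) / Real.sin (θ₁ u) := by
    intro u hu
    have s1 := hT1 u hu
    have s2 := hT2 u hu
    have hb1 := (hU₀ u (hUU.trans hu))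
    have hb2 := hgt u hu
    have hb3 := hlt1 u hu
    have hd : 0 < Real.sin (θ₁ u - θ₂ u) :=
      Real.sin_pos_of_pos_of_lt_pi (by linarith) (by linarith [Real.pi_pos])
    have hprod : 0 < Real.sin (θ₁ u) * Real.sin (θ₂ u) := by
      have e : Real.sin (θ₁ u) * Real.sin (θ₂ u)
          = Real.sin (θ₁ u - p * Real.pi) * Real.sin (θ₂ u - p * Real.pi) := by
        rw [Real.sin_sub_int_mul_pi, Real.sin_sub_int_mul_pi]
        have : ((-1 : ℝ) ^ p) * ((-1 : ℝ) ^ p) = 1 := by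
          rw [← mul_zpow]; norm_num
        linear_combination (- Real.sin (θ₁ u) * Real.sin (θ₂ u)) * this
      rw [e]
      have hpi := Real.pi_pos
      exact mul_pos_of_neg_of_neg
        (Real.sin_neg_of_neg_of_neg_pi_lt (by linarith) (by linarith))
        (Real.sin_neg_of_neg_of_neg_pi_lt (by linarith) (by linarith))
    have e2 : Real.cos (θ₂ u) / Real.sin (θ₂ u) - Real.cos (θ₁ u) / Real.sin (θ₁ u)
        = Real.sin (θ₁ u - θ₂ u) / (Real.sin (θ₁ u) * Real.sin (θ₂ u)) := by
      have := s1.1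
      have := s2.1
      rw [Real.sin_sub]
      field_simp
    rw [e2]
    exact div_pos hd hprod
  refine blowup (U := U) (fun u hu => (hasDerivAt_cot_psol h₂ (hT2 u hu).1).sub
    (hasDerivAt_cot_psol h₁ (hT1 u hu).1)) hpos ?_
  intro u hu
  have hp := hpos u hu
  have hn := hneg _ (hT2 u hu).1 (hT2 u hu).2
  have hq := hlt u (by linarith)
  simp only [Pi.sub_apply]
  set w₁ := Real.cos (θ₁ u) / Real.sin (θ₁ u)
  set w₂ := Real.cos (θ₂ u) / Real.sin (θ₂ u)
  nlinarith [mul_pos hp (neg_pos.2 hn)]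

lemma eig_of_tail {V θ : ℝ → ℝ} (hV : Continuous V) (hVt : Tendsto V atTop atTop) {E a α σ β : ℝ}
    (hc : Real.cos α = σ * Real.cos β) (hs : Real.sin α = -σ * Real.sin β)
    (hθ : PSol (fun u => 1 + V u - E) θ) (h0 : θ a = β) {p : ℤ} (hp : Tail θ p) :
    E ∈ evSet α a V := by
  have hθc := hθ.cont
  set k : ℝ → ℝ := fun u => (1 + V u - E) * Real.sin (θ u) * Real.cos (θ u) with hk
  have hkc : Continuous k := by fun_prop
  set R : ℝ → ℝ := fun u => Real.exp (∫ s in a..u, k s) with hR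
  have hRpos : ∀ u, 0 < R u := fun u => Real.exp_pos _
  have hRd : ∀ u, HasDerivAt R (R u * k u) u := by
    intro u
    exact (intervalIntegral.integral_hasDerivAt_right (hkc.intervalIntegrable _ _)
      (hkc.stronglyMeasurableAtFilter _ _) hkc.continuousAt).exp
  have hRc : Continuous R := continuous_iff_continuousAt.2 fun u => (hRd u).continuousAt
  have hf : ∀ u, HasDerivAt (fun u => R u * Real.sin (θ u)) (R u * Real.cos (θ u)) u := by
    intro u
    refine ((hRd u).mul (hθ u).sin).congr_deriv ?_
    simp only [hk]
    ring
  have hfd : deriv (fun u => R u * Real.sin (θ u)) = fun u => R u * Real.cos (θ u) :=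
    funext fun u => (hf u).deriv
  have hf' : ∀ u, HasDerivAt (fun u => R u * Real.cos (θ u))
      ((V u - E) * (R u * Real.sin (θ u))) u := by
    intro u
    refine ((hRd u).mul (hθ u).cos).congr_deriv ?_
    simp only [hk]
    linear_combination (R u * (1 + V u - E) * Real.sin (θ u)) * Real.sin_sq_add_cos_sq (θ u)
  obtain ⟨U₀, hU₀⟩ := hp
  refine ⟨fun u => R u * Real.sin (θ u), fun u => (hf u).differentiableAt, ?_, ?_, ?_, ?_, ?_⟩
  · rw [hfd]; exact fun u => (hf' u).differentiableAt
  · refine ⟨max a U₀, le_max_left _ _, ?_⟩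
    have := hU₀ (max a U₀) (le_max_right _ _)
    exact mul_ne_zero (hRpos _).ne' (sin_sub_pi this.1 this.2).1
  · obtain ⟨U₁, hU₁⟩ := eventually_atTop.1 (hVt.eventually_ge_atTop (E + 1))
    set U := max (max a U₀) U₁ with hU
    have hUa : a ≤ U := (le_max_left _ _).trans (le_max_left _ _)
    have hU0 : U₀ ≤ U := (le_max_right _ _).trans (le_max_left _ _)
    have hU1 : U₁ ≤ U := le_max_right _ _
    have hcont : Continuous fun u => (R u * Real.sin (θ u)) ^ 2 := by fun_prop
    have hint : IntegrableOn (fun u => (R u * Real.sin (θ u)) ^ 2) (Ioi U) := by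
      refine integrableOn_Ioi_of_intervalIntegral_norm_bounded
        (-(R U * Real.sin (θ U) * (R U * Real.cos (θ U)))) U (b := fun t : ℝ => t) (l := atTop)
        (fun i => (hcont.integrableOn_Icc).mono_set Ioc_subset_Icc_self) tendsto_id ?_
      filter_upwards [eventually_ge_atTop U] with N hN
      have hFd : ∀ u, HasDerivAt (fun N => (R N * Real.sin (θ N) * (R N * Real.cos (θ N)))
          - ∫ x in U..N, (R x * Real.sin (θ x)) ^ 2)
          ((R u * Real.cos (θ u) * (R u * Real.cos (θ u)) +
            R u * Real.sin (θ u) * ((V u - E) * (R u * Real.sin (θ u))))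
            - (R u * Real.sin (θ u)) ^ 2) u := by
        intro u
        exact ((hf u).mul (hf' u)).sub
          (intervalIntegral.integral_hasDerivAt_right (hcont.intervalIntegrable _ _)
            (hcont.stronglyMeasurableAtFilter _ _) hcont.continuousAt)
      have hm : MonotoneOn (fun N => (R N * Real.sin (θ N) * (R N * Real.cos (θ N)))
          - ∫ x in U..N, (R x * Real.sin (θ x)) ^ 2) (Ici U) := by
        apply monotoneOn_of_deriv_nonneg (convex_Ici U)
        · exact fun u hu => (hFd u).continuousAt.continuousWithinAt
        · exact fun u hu => (hFd u).differentiableAt.differentiableWithinAt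
        · intro u hu
          rw [interior_Ici] at hu
          have hu : U ≤ u := le_of_lt hu
          have := hU₁ u (hU1.trans hu)
          rw [(hFd u).deriv]
          nlinarith [sq_nonneg (R u * Real.cos (θ u)), sq_nonneg (R u * Real.sin (θ u))]
      have h1 := hm (mem_Ici.2 le_rfl) (mem_Ici.2 hN) hN
      simp only [intervalIntegral.integral_same] at h1
      have h2 := hU₀ N (hU0.trans hN)
      have h3 := (sin_sub_pi h2.1 h2.2).2
      have h4 : R N * Real.sin (θ N) * (R N * Real.cos (θ N)) ≤ 0 := by
        have := mul_nonneg (sq_nonneg (R N)) (neg_pos.2 h3).le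
        nlinarith
      have h5 : ∀ x, ‖(R x * Real.sin (θ x)) ^ 2‖ = (R x * Real.sin (θ x)) ^ 2 := fun x =>
        Real.norm_of_nonneg (sq_nonneg _)
      simp only [h5]
      linarith
    have hsplit : Ici a = Icc a U ∪ Ioi U := (Icc_union_Ioi_eq_Ici hUa).symm
    rw [hsplit]
    exact (hcont.integrableOn_Icc).union hint
  · intro u _
    rw [hfd, (hf' u).deriv]
    ring
  · rw [hfd]
    simp only [hc, hs, h0]
    ring

lemma sq_sin_half (p : ℤ) : Real.sin (p * Real.pi + Real.pi / 2) ^ 2 = 1 := by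
  rw [Real.sin_add_pi_div_two, Real.cos_int_mul_pi, ← zpow_natCast, ← zpow_mul, mul_comm, zpow_mul]
  norm_num

lemma tail_of_eig {V θ : ℝ → ℝ} (hV : Continuous V) (hVt : Tendsto V atTop atTop) {E a α σ β : ℝ}
    (hσ : σ ≠ 0) (hβ : 0 ≤ β)
    (hc : Real.cos α = σ * Real.cos β) (hs : Real.sin α = -σ * Real.sin β)
    (hθ : PSol (fun u => 1 + V u - E) θ) (h0 : θ a = β) (hE : E ∈ evSet α a V) :
    ∃ p : ℤ, 1 ≤ p ∧ Tail θ p := by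
  obtain ⟨ψ, hd1, hd2, ⟨x, hax, hx⟩, hint, hode, hbc⟩ := hE
  have hθc := hθ.cont
  have hQc : Continuous fun u => 1 + V u - E := by fun_prop
  have hψ : ∀ u, HasDerivAt ψ (deriv ψ u) u := fun u => (hd1 u).hasDerivAt
  have hψ' : ∀ u, a ≤ u → HasDerivAt (deriv ψ) ((V u - E) * ψ u) u := fun u hu =>
    (hd2 u).hasDerivAt.congr_deriv (by have := hode u hu; linarith)
  have hkc : Continuous fun u => (1 + V u - E) * Real.sin (θ u) * Real.cos (θ u) := by fun_prop
  have hD : ∀ u, a ≤ u → ψ u * Real.cos (θ u) - deriv ψ u * Real.sin (θ u) = 0 := by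
    intro u hu
    refine lin_zero (D := fun u => ψ u * Real.cos (θ u) - deriv ψ u * Real.sin (θ u)) hu hkc ?_ ?_
    · intro v hv
      refine (((hψ v).mul (hθ v).cos).sub ((hψ' v hv.1).mul (hθ v).sin)).congr_deriv ?_
      have e := Real.cos_sq' (θ v)
      have e3 : Real.sin (θ v) ^ 3 = Real.sin (θ v) - Real.sin (θ v) * Real.cos (θ v) ^ 2 := by
        rw [e]; ring
      linear_combination (ψ v * (1 + V v - E)) * e3
    · simp only [h0]
      rw [hc, hs] at hbc
      have : σ * (ψ a * Real.cos β - deriv ψ a * Real.sin β) = 0 := by linear_combination hbc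
      exact (mul_eq_zero.1 this).resolve_left hσ
  set R : ℝ → ℝ := fun u => ψ u * Real.sin (θ u) + deriv ψ u * Real.cos (θ u) with hR
  have hRd : ∀ u, a ≤ u → HasDerivAt R
      (-(-((1 + V u - E) * Real.sin (θ u) * Real.cos (θ u))) * R u) u := by
    intro u hu
    refine (((hψ u).mul (hθ u).sin).add ((hψ' u hu).mul (hθ u).cos)).congr_deriv ?_
    simp only [hR]
    linear_combination ((1 + V u - E) * (Real.cos (θ u) ^ 2 - Real.sin (θ u) ^ 2)) * hD u hu
      - (ψ u * Real.cos (θ u) * (1 + V u - E)) * Real.sin_sq_add_cos_sq (θ u)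
  have e1 : ∀ u, a ≤ u → ψ u = R u * Real.sin (θ u) := by
    intro u hu
    simp only [hR]
    linear_combination (Real.cos (θ u)) * hD u hu - (ψ u) * Real.sin_sq_add_cos_sq (θ u)
  have e2 : ∀ u, a ≤ u → deriv ψ u = R u * Real.cos (θ u) := by
    intro u hu
    simp only [hR]
    linear_combination (-Real.sin (θ u)) * hD u hu - (deriv ψ u) * Real.sin_sq_add_cos_sq (θ u)
  have hRa : R a ≠ 0 := by
    intro h
    have := lin_zero hax hkc.neg (fun u hu => hRd u hu.1) h
    apply hx
    rw [e1 x hax, this, zero_mul]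
  have hRne : ∀ u, a ≤ u → R u ≠ 0 := fun u hu =>
    lin_ne hu hkc.neg (fun u hu => hRd u hu.1) hRa
  obtain ⟨U₁, hU₁⟩ := eventually_atTop.1 (hVt.eventually_ge_atTop (E + 1))
  set U := max (a + 1) U₁ with hU
  have hUa : a + 1 ≤ U := le_max_left _ _
  have hU1 : U₁ ≤ U := le_max_right _ _
  have hpi := Real.pi_pos
  have hno : ∀ u, U ≤ u → ∀ p : ℤ, p * Real.pi ≤ θ u → θ u ≤ p * Real.pi + Real.pi / 2 → False := by
    intro u hu p hp1 hp2
    have hq : ∀ v, u < v → 0 < Real.sin (θ v) * Real.cos (θ v) := by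
      intro v hv
      have b1 := barrier_low hQc hθ p hv hp1
      have b2 := barrier_up hQc hθ (p * Real.pi + Real.pi / 2) hv (fun w hw => by
        rw [sq_sin_half]; have := hU₁ w (by linarith [hw.1]); linarith) hp2
      have e : Real.sin (2 * θ v) = Real.sin (2 * θ v - p * (2 * Real.pi)) :=
        (Real.sin_sub_int_mul_two_pi _ _).symm
      have : 0 < Real.sin (2 * θ v) := by
        rw [e]
        apply Real.sin_pos_of_pos_of_lt_pi <;> linarith
      rw [Real.sin_two_mul] at this
      linarith
    have hder : ∀ v, HasDerivAt (fun v => ψ v ^ 2) (2 * ψ v * deriv ψ v) v := fun v =>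
      ((hψ v).pow 2).congr_deriv (by norm_num)
    have hm : MonotoneOn (fun v => ψ v ^ 2) (Ici u) := by
      apply monotoneOn_of_deriv_nonneg (convex_Ici u)
      · exact fun v hv => (hder v).continuousAt.continuousWithinAt
      · exact fun v hv => (hder v).differentiableAt.differentiableWithinAt
      · intro v hv
        rw [interior_Ici] at hv
        have hv : u < v := hv
        rw [(hder v).deriv, e1 v (by linarith), e2 v (by linarith)]
        have := mul_nonneg (sq_nonneg (R v)) (hq v hv).le
        nlinarith
    have hpos : 0 < ψ (u + 1) ^ 2 := by
      have : ψ (u + 1) ≠ 0 := by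
        rw [e1 _ (by linarith)]
        refine mul_ne_zero (hRne _ (by linarith)) ?_
        intro h
        have := hq (u + 1) (by linarith)
        rw [h] at this; simp at this
      positivity
    have hi : IntegrableOn (fun v => ψ v ^ 2) (Ici (u + 1)) :=
      hint.mono_set (Ici_subset_Ici.2 (by linarith))
    have hi2 : IntegrableOn (fun _ : ℝ => ψ (u + 1) ^ 2) (Ici (u + 1)) := by
      refine Integrable.mono' hi aestronglyMeasurable_const ?_
      refine (ae_restrict_iff' measurableSet_Ici).2 (Eventually.of_forall fun v hv => ?_)
      have hv : u + 1 ≤ v := hv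
      rw [Real.norm_of_nonneg hpos.le]
      exact hm (mem_Ici.2 (by linarith)) (mem_Ici.2 (by linarith)) hv
    rw [integrableOn_const_iff] at hi2
    rcases hi2 with h | h
    · exact hpos.ne' (by simpa using h)
    · simp at h
  set p : ℤ := ⌈θ U / Real.pi⌉ with hp
  have hp1 : θ U ≤ p * Real.pi := (div_le_iff₀ hpi).1 (Int.le_ceil _)
  have hp2 : (p - 1) * Real.pi < θ U := by
    have := Int.ceil_lt_add_one (θ U / Real.pi)
    rw [← lt_div_iff₀ hpi]; linarith
  have hA : ∀ u, U ≤ u → θ u ≠ p * Real.pi := fun u hu h =>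
    hno u hu p h.ge (by linarith)
  have hB : ∀ u, U ≤ u → θ u ≠ p * Real.pi - Real.pi / 2 := fun u hu h =>
    hno u hu (p - 1) (by push_cast; linarith) (by push_cast; linarith)
  have hUlt : θ U < p * Real.pi := lt_of_le_of_ne hp1 (hA U le_rfl)
  have hUgt : p * Real.pi - Real.pi / 2 < θ U := by
    by_contra hcon
    push Not at hcon
    exact hno U le_rfl (p - 1) (by push_cast; linarith) (by push_cast; linarith)
  have hT : ∀ u, U ≤ u → p * Real.pi - Real.pi / 2 < θ u ∧ θ u < p * Real.pi := by
    intro u hu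
    constructor
    · by_contra hcon
      push Not at hcon
      obtain ⟨w, hw, hw2⟩ := intermediate_value_Icc' hu hθc.continuousOn ⟨hcon, hUgt.le⟩
      exact hB w hw.1 hw2
    · by_contra hcon
      push Not at hcon
      obtain ⟨w, hw, hw2⟩ := intermediate_value_Icc hu hθc.continuousOn ⟨hUlt.le, hcon⟩
      exact hA w hw.1 hw2
  refine ⟨p, ?_, U, hT⟩
  have := barrier_low hQc hθ 0 (show a < U by linarith) (by rw [h0]; simpa using hβ)
  have h3 : 0 < (p : ℝ) * Real.pi := by
    have : (0 : ℝ) < θ U := by simpa using this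
    linarith
  have h4 : (0 : ℝ) < p := pos_of_mul_pos_left h3 hpi.le
  exact_mod_cast h4

/-- If at energy `F` the angle passes `jπ`, there is an energy `E < F` with tail number `j`. -/
lemma exists_tail {V : ℝ → ℝ} (hV : Continuous V) (hVt : Tendsto V atTop atTop) {a L β F : ℝ}
    (hL : ∀ u, a ≤ u → L ≤ V u) (hβ : 0 ≤ β) (hβ' : β < Real.pi)
    {θ : ℝ → ℝ → ℝ} (hθ : ∀ E, PSol (fun u => 1 + V u - E) (θ E)) (h0 : ∀ E, θ E a = β)
    {j : ℤ} (hj : 1 ≤ j) (hF : ∃ u, a ≤ u ∧ j * Real.pi < θ F u) :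
    ∃ E, E < F ∧ Tail (θ E) j := by
  have hpi := Real.pi_pos
  have hQc : ∀ E, Continuous fun u => 1 + V u - E := fun E => by fun_prop
  have hj' : (1 : ℝ) ≤ j := by exact_mod_cast hj
  set A : Set ℝ := {E | ∃ u, a ≤ u ∧ j * Real.pi < θ E u} with hA
  have hopen : IsOpen A := by
    have : A = ⋃ u ∈ Ici a, {E | j * Real.pi < θ E u} := by
      ext E; simp [hA]
    rw [this]
    exact isOpen_biUnion fun u hu =>
      isOpen_lt continuous_const (cont_energy hV hu β hθ h0)
  have hbdd : BddBelow A := by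
    set γ := (β + Real.pi) / 2 with hγ
    have hsin : 0 < Real.sin γ := Real.sin_pos_of_pos_of_lt_pi (by linarith) (by linarith)
    refine ⟨L - 1 / Real.sin γ ^ 2, fun E hE => ?_⟩
    obtain ⟨u, hu, hu2⟩ := hE
    by_contra hcon
    push Not at hcon
    have hlt : θ E u < Real.pi := by
      rcases hu.eq_or_lt with h | h
      · rw [← h, h0]; exact hβ'
      · have := barrier_up (hQc E) (hθ E) γ h (fun w hw => by
          have h1 := hL w hw.1.le
          have h2 : 1 / Real.sin γ ^ 2 < 1 + V w - E := by linarith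
          rwa [div_lt_iff₀ (by positivity)] at h2) (by rw [h0]; linarith)
        linarith
    nlinarith
  have hne : A.Nonempty := ⟨F, hF⟩
  have hEF : sInf A < F := by
    obtain ⟨l, hl, hl2⟩ := exists_Ioc_subset_of_mem_nhds (hopen.mem_nhds (show F ∈ A from hF))
      (exists_lt F)
    have : (l + F) / 2 ∈ A := hl2 ⟨by linarith, by linarith⟩
    have := csInf_le hbdd this
    linarith
  have hnot : sInf A ∉ A := by
    intro h
    obtain ⟨l, hl, hl2⟩ := exists_Ioc_subset_of_mem_nhds (hopen.mem_nhds h) (exists_lt _)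
    have : (l + sInf A) / 2 ∈ A := hl2 ⟨by linarith, by linarith⟩
    have := csInf_le hbdd this
    linarith
  refine ⟨sInf A, hEF, ?_⟩
  set S := sInf A with hS
  have hle : ∀ u, a ≤ u → θ S u ≤ j * Real.pi := by
    intro u hu
    by_contra hcon
    push Not at hcon
    exact hnot ⟨u, hu, hcon⟩
  obtain ⟨U₁, hU₁⟩ := eventually_atTop.1 (hVt.eventually_ge_atTop (S + 2))
  refine ⟨max a U₁, fun u hu => ?_⟩
  have hua : a ≤ u := (le_max_left _ _).trans hu
  have huU : U₁ ≤ u := (le_max_right _ _).trans hu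
  have hsj : Real.sin (j * Real.pi - Real.pi / 2) ^ 2 = 1 := by
    have := sq_sin_half (j - 1)
    rw [← this]
    congr 2
    push_cast
    ring
  constructor
  · by_contra hcon
    push Not at hcon
    have h1 := barrier_up (hQc S) (hθ S) (j * Real.pi - Real.pi / 2) (lt_add_one u)
      (fun w hw => by rw [hsj]; have := hU₁ w (by linarith [hw.1]); linarith) hcon
    have hcE := cont_energy hV (show a ≤ u + 1 by linarith) β hθ h0
    have hev : ∀ᶠ E in 𝓝 S, θ E (u + 1) < j * Real.pi - Real.pi / 2 ∧ E < S + 1 :=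
      (hcE.continuousAt.eventually (gt_mem_nhds h1)).and (gt_mem_nhds (lt_add_one S))
    obtain ⟨r, hr, hr2⟩ := exists_Ico_subset_of_mem_nhds hev (exists_gt S)
    obtain ⟨E, hEA, hEr⟩ := exists_lt_of_csInf_lt hne hr
    have hSE : S ≤ E := csInf_le hbdd hEA
    have hE := hr2 ⟨hSE, hEr⟩
    obtain ⟨w, hw, hw2⟩ := hEA
    have hE1 : θ E (u + 1) < j * Real.pi - Real.pi / 2 := hE.1
    have hE2 : E < S + 1 := hE.2
    rcases lt_trichotomy w (u + 1) with h | h | h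
    · have := barrier_low (hQc E) (hθ E) j h hw2.le
      linarith
    · rw [h] at hw2; linarith
    · have := barrier_up (hQc E) (hθ E) (j * Real.pi - Real.pi / 2) h
        (fun w hw => by rw [hsj]; have := hU₁ w (by linarith [hw.1]); linarith) hE1.le
      linarith
  · by_contra hcon
    push Not at hcon
    have := barrier_low (hQc S) (hθ S) j (lt_add_one u) hcon
    have := hle (u + 1) (by linarith)
    linarith

lemma tail_unique {θ : ℝ → ℝ} {p q : ℤ} (hp : Tail θ p) (hq : Tail θ q) : p = q := by
  obtain ⟨U, hU⟩ := hp
  obtain ⟨W, hW⟩ := hq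
  have h1 := hU (max U W) (le_max_left _ _)
  have h2 := hW (max U W) (le_max_right _ _)
  have hpi := Real.pi_pos
  have a1 : (p : ℝ) < q + 1 := by
    by_contra h; push Not at h; nlinarith
  have a2 : (q : ℝ) < p + 1 := by
    by_contra h; push Not at h; nlinarith
  have a3 : p < q + 1 := by exact_mod_cast a1
  have a4 : q < p + 1 := by exact_mod_cast a2
  omega

lemma shift_ev {α a h E : ℝ} {V : ℝ → ℝ} (hE : E ∈ evSet α (a + h) V) :
    E ∈ evSet α a (fun u => V (u + h)) := by
  obtain ⟨ψ, hd1, hd2, ⟨x, hax, hx⟩, hint, hode, hbc⟩ := hE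
  have e : deriv (fun u => ψ (u + h)) = fun u => deriv ψ (u + h) :=
    funext fun u => deriv_comp_add_const ψ h u
  refine ⟨fun u => ψ (u + h), ?_, ?_, ⟨x - h, by linarith, by simpa using hx⟩, ?_, ?_, ?_⟩
  · exact fun u => ((hd1 (u + h)).hasDerivAt.comp_add_const u h).differentiableAt
  · rw [e]
    exact fun u => ((hd2 (u + h)).hasDerivAt.comp_add_const u h).differentiableAt
  · have := ((measurePreserving_add_right volume h).integrableOn_comp_preimage
      (measurableEmbedding_addRight h) (f := fun u => ψ u ^ 2) (s := Ici (a + h))).2 hint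
    simpa [Function.comp_def] using this
  · intro u hu
    rw [e, deriv_comp_add_const (deriv ψ) h u]
    exact hode (u + h) (by linarith)
  · rw [e]
    exact hbc

lemma exists_beta (α : ℝ) (h0 : 0 ≤ α) (h1 : α < 2 * Real.pi) :
    ∃ β σ : ℝ, 0 ≤ β ∧ β < Real.pi ∧ σ ≠ 0 ∧ Real.cos α = σ * Real.cos β ∧
      Real.sin α = -σ * Real.sin β := by
  have hpi := Real.pi_pos
  rcases h0.eq_or_lt with h | h
  · exact ⟨0, 1, le_rfl, hpi, one_ne_zero, by simp [← h], by simp [← h]⟩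
  rcases le_or_gt α Real.pi with h2 | h2
  · exact ⟨Real.pi - α, -1, by linarith, by linarith, by norm_num, by simp, by simp⟩
  · exact ⟨2 * Real.pi - α, 1, by linarith, by linarith, by norm_num, by simp, by simp⟩

lemma morse_cont (k : ℝ) : Continuous (morse k) := by
  unfold morse; fun_prop

lemma morse_eq (k u : ℝ) : morse k u = (Real.exp u / 2 + k) ^ 2 - k ^ 2 := by
  unfold morse
  rw [two_mul, Real.exp_add]; ring

lemma morse_tendsto (k : ℝ) : Tendsto (morse k) atTop atTop := by
  have e : morse k = fun u => (Real.exp u / 2 + k) ^ 2 - k ^ 2 := funext (morse_eq k)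
  rw [e]
  apply tendsto_atTop_add_const_right
  refine (tendsto_pow_atTop (two_ne_zero)).comp ?_
  apply tendsto_atTop_add_const_right
  exact Real.tendsto_exp_atTop.atTop_div_const two_pos

lemma morse_lt {k a u v : ℝ} (hk : k < 0) (ha : Real.log (2 * |k|) ≤ a) (hu : a ≤ u) (huv : u < v) :
    morse k u < morse k v := by
  have h1 : 2 * |k| ≤ Real.exp u := by
    have : 0 < 2 * |k| := by have := abs_pos.2 hk.ne; linarith
    rw [← Real.exp_log this]
    exact Real.exp_le_exp.2 (ha.trans hu)
  rw [abs_of_neg hk] at h1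
  have h2 := Real.exp_lt_exp.2 huv
  rw [morse_eq, morse_eq]
  nlinarith

theorem stmt_6 (α k u₀ u₀' : ℝ) (hα0 : 0 ≤ α) (hα1 : α < 2 * Real.pi) (hk : k < 0)
    (hu0 : Real.log (2 * |k|) ≤ u₀) (hu : u₀ < u₀')
    (e e' : ℕ → ℝ) (he : StrictMono e) (he' : StrictMono e')
    (hre : Set.range e = evSet α u₀ (morse k))
    (hre' : Set.range e' = evSet α u₀' (morse k)) :
    ∀ n : ℕ, e n < e' n := by
  intro n
  obtain ⟨β, σ, hβ0, hβ1, hσ, hc, hs⟩ := exists_beta α hα0 hα1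
  obtain ⟨h, rfl⟩ : ∃ h, u₀' = u₀ + h := ⟨u₀' - u₀, by ring⟩
  have hh : 0 < h := by linarith
  have hVc := morse_cont k
  have hVt := morse_tendsto k
  set W : ℝ → ℝ := fun u => morse k (u + h) with hW
  have hWc : Continuous W := by fun_prop
  have hWt : Tendsto W atTop atTop := hVt.comp (tendsto_atTop_add_const_right _ _ tendsto_id)
  have hVW : ∀ u, u₀ ≤ u → morse k u < W u := fun u hu =>
    morse_lt hk hu0 hu (by linarith)
  have hpi := Real.pi_pos
  choose θ hθ0 hθ using fun E : ℝ =>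
    exists_psol (Q := fun u => 1 + morse k u - E) (by fun_prop) u₀ β
  choose η hη0 hη using fun E : ℝ =>
    exists_psol (Q := fun u => 1 + W u - E) (by fun_prop) u₀ β
  have hev : ∀ m, e' m ∈ evSet α u₀ W := fun m =>
    shift_ev (hre' ▸ mem_range_self m)
  choose p hp1 hp using fun m => tail_of_eig hWc hWt hσ hβ0 hc hs (hη (e' m)) (hη0 _) (hev m)
  have hpm : ∀ m, p m < p (m + 1) := by
    intro m
    obtain ⟨u, hu, hu2⟩ := strict_tail (Q₁ := fun u => 1 + W u - e' (m + 1)) (by fun_prop)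
      (by fun_prop) (hη (e' (m + 1))) (hη (e' m)) (a := u₀)
      (fun u _ => by have := he' (Nat.lt_succ_self m); simp only [Nat.succ_eq_add_one] at this
                     linarith)
      (by rw [hη0, hη0]) (hp m)
    obtain ⟨U, hU⟩ := hp (m + 1)
    have h1 := hU (max U (u + 1)) (le_max_left _ _)
    have h2 := barrier_low (by fun_prop) (hη (e' (m + 1))) (p m)
      (show u < max U (u + 1) from (lt_add_one u).trans_le (le_max_right _ _)) hu2.le
    have h3 : (p m : ℝ) < p (m + 1) := lt_of_mul_lt_mul_right (h2.trans h1.2) hpi.le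
    exact_mod_cast h3
  have hpn : ∀ m : ℕ, (m : ℤ) + 1 ≤ p m := by
    intro m
    induction m with
    | zero => simpa using hp1 0
    | succ m ih => have := hpm m; push_cast; omega
  obtain ⟨u, hu1, hu2⟩ := strict_tail (Q₁ := fun u => 1 + morse k u - e' n) (by fun_prop)
      (by fun_prop) (hθ (e' n)) (hη (e' n)) (a := u₀)
      (fun u hu => by have := hVW u hu; linarith) (by rw [hη0, hθ0]) (hp n)
  have hex : ∀ i : Fin (n + 1), ∃ E, E < e' n ∧ Tail (θ E) ((i : ℕ) + 1 : ℤ) := by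
    intro i
    refine exists_tail hVc hVt (L := morse k u₀) ?_ hβ0 hβ1 hθ hθ0 (by omega) ⟨u, hu1, ?_⟩
    · intro v hv
      rcases hv.eq_or_lt with h | h
      · rw [h]
      · exact (morse_lt hk hu0 le_rfl h).le
    · refine lt_of_le_of_lt ?_ hu2
      have h1 := hpn n
      have h2 := i.2
      have h3 : ((i : ℕ) + 1 : ℤ) ≤ p n := by omega
      have h4 : ((((i : ℕ) + 1 : ℤ)) : ℝ) ≤ p n := by exact_mod_cast h3
      exact mul_le_mul_of_nonneg_right h4 hpi.le
  choose G hG1 hG2 using hex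
  have hGe : ∀ i, ∃ m, e m = G i := by
    intro i
    have : G i ∈ range e := by
      rw [hre]
      exact eig_of_tail hVc hVt hc hs (hθ _) (hθ0 _) (hG2 i)
    exact this
  choose idx hidx using hGe
  by_contra hcon
  push Not at hcon
  have hlt : ∀ i, idx i < n := by
    intro i
    rw [← he.lt_iff_lt, hidx]
    exact (hG1 i).trans_le hcon
  have hinj : Function.Injective (fun i => (⟨idx i, hlt i⟩ : Fin n)) := by
    intro i j hij
    have h1 : idx i = idx j := by simpa using hij
    have h2 : G i = G j := by rw [← hidx, ← hidx, h1]
    have h3 := hG2 i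
    rw [h2] at h3
    have := tail_unique h3 (hG2 j)
    apply Fin.ext
    omega
  have := Fintype.card_le_of_injective _ hinj
  simp at this
end
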